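/- arXiv:1902.03730 — 5 statements merged into one kernel-verified Lean document; each statement's English description precedes it below -/
import Mathlib

section
/- Let P = conv(v_0, …, v_d) ⊂ ℝ^d be a very ample lattice d-simplex, let k ≥ 1 be an integer, and let x ∈ kP ∩ M. Then for every index i ∈ {0, …, d} there exist lattice points u_1, …, u_{2k−1} ∈ P ∩ M such that x + (k−1)·v_i = u_1 + ⋯ + u_{2k−1}. -/
open Set MeasureTheory
open scoped Pointwise

/-- A point of `ℝ^n` is a lattice point if all its coordinates are integers. -/
def IsLatticePt {n : ℕ} (x : Fin n → ℝ) : Prop := ∀ i, ∃ z : ℤ, x i = (z : ℝ)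

/-- The set of lattice points of a subset of `ℝ^n`. -/
def latticePts {n : ℕ} (S : Set (Fin n → ℝ)) : Set (Fin n → ℝ) := {x ∈ S | IsLatticePt x}

/-- `P` is `k`-normal: every lattice point of the dilate `k • P` is a sum of `k`
lattice points of `P`. -/
def IsKNormal {n : ℕ} (P : Set (Fin n → ℝ)) (k : ℕ) : Prop :=
  ∀ x ∈ latticePts ((k : ℝ) • P),
    ∃ u : Fin k → Fin n → ℝ, (∀ j, u j ∈ latticePts P) ∧ x = ∑ j, u j

/-- The `k`-normality `k_P`: the least positive integer such that `P` is `k`-normal for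
all `k ≥ k_P`. -/
noncomputable def kNormality {n : ℕ} (P : Set (Fin n → ℝ)) : ℕ :=
  sInf {m | 0 < m ∧ ∀ k, m ≤ k → IsKNormal P k}

/-- The real cone generated by a set `S` (for convex `S`, all nonnegative multiples of
points of `S`). -/
def coneOver {n : ℕ} (S : Set (Fin n → ℝ)) : Set (Fin n → ℝ) :=
  {x | ∃ t : ℝ, ∃ p ∈ S, 0 ≤ t ∧ x = t • p}

/-- `P` is very ample: for every vertex (= extreme point) `v` of `P`, every lattice point
of the real cone generated by `P - v` is a finite sum of elements of `(P ∩ M) - v`. -/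
def IsVeryAmple {n : ℕ} (P : Set (Fin n → ℝ)) : Prop :=
  ∀ v ∈ P.extremePoints ℝ, ∀ x : Fin n → ℝ, IsLatticePt x →
    x ∈ coneOver ((fun p => p - v) '' P) →
    ∃ (m : ℕ) (u : Fin m → Fin n → ℝ), (∀ j, u j ∈ latticePts P) ∧ x = ∑ j, (u j - v)

/-- The invariant `d_P`: the smallest positive integer such that
`(k+1)P ∩ M = (P ∩ M) + (kP ∩ M)` for all `k ≥ d_P`. -/
noncomputable def dInv {n : ℕ} (P : Set (Fin n → ℝ)) : ℕ :=
  sInf {m | 0 < m ∧ ∀ k : ℕ, m ≤ k →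
    latticePts (((k : ℝ) + 1) • P) = latticePts P + latticePts ((k : ℝ) • P)}

/-- The invariant `ν_P` (relative to a set `V`, typically the vertex set of `P`): the
smallest positive integer such that `(k+1)P ∩ M = V + (kP ∩ M)` for all `k ≥ ν_P`. -/
noncomputable def nuInv {n : ℕ} (V P : Set (Fin n → ℝ)) : ℕ :=
  sInf {m | 0 < m ∧ ∀ k : ℕ, m ≤ k →
    latticePts (((k : ℝ) + 1) • P) = V + latticePts ((k : ℝ) • P)}

/-- The normalized volume of `P ⊆ ℝ^n`: `n!` times its Euclidean (Lebesgue) volume. -/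
noncomputable def nVol {n : ℕ} (P : Set (Fin n → ℝ)) : ℝ :=
  (n.factorial : ℝ) * (volume P).toReal

open Classical in
/-- The degree of a lattice `n`-polytope `P`: `n` if `P` has an interior lattice point,
and otherwise the least `i ≥ 0` such that `(kP)° ∩ M = ∅` for all `1 ≤ k ≤ n - i`. -/
noncomputable def polyDeg {n : ℕ} (P : Set (Fin n → ℝ)) : ℕ :=
  if (latticePts (interior P)).Nonempty then n
  else sInf {i | ∀ k : ℕ, 1 ≤ k → k ≤ n - i → latticePts (interior ((k : ℝ) • P)) = ∅}

theorem IsLatticePt.add {n : ℕ} {x y : Fin n → ℝ} (hx : IsLatticePt x) (hy : IsLatticePt y) :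
    IsLatticePt (x + y) := fun i => by
  obtain ⟨a, ha⟩ := hx i
  obtain ⟨b, hb⟩ := hy i
  exact ⟨a + b, by simp [ha, hb]⟩

theorem IsLatticePt.sub {n : ℕ} {x y : Fin n → ℝ} (hx : IsLatticePt x) (hy : IsLatticePt y) :
    IsLatticePt (x - y) := fun i => by
  obtain ⟨a, ha⟩ := hx i
  obtain ⟨b, hb⟩ := hy i
  exact ⟨a - b, by simp [ha, hb]⟩

theorem IsLatticePt.nsmul {n : ℕ} {x : Fin n → ℝ} (hx : IsLatticePt x) (k : ℕ) :
    IsLatticePt ((k : ℝ) • x) := fun i => by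
  obtain ⟨a, ha⟩ := hx i
  exact ⟨k * a, by simp [ha]⟩

/-- Two terms of a sum of differences from `v` can be merged into one. -/
theorem exists_sum_sub_eq_of_add_sub_mem {E : Type*} [AddCommGroup E] {S : Set E} {v : E} {n : ℕ}
    {u : Fin (n + 1) → E} (hu : ∀ j, u j ∈ S) {s t : Fin (n + 1)} (hst : s ≠ t)
    (h : u s + u t - v ∈ S) :
    ∃ w : Fin n → E, (∀ j, w j ∈ S) ∧ ∑ j, (w j - v) = ∑ j, (u j - v) := by
  obtain ⟨r, rfl⟩ := Fin.exists_succAbove_eq hst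
  refine ⟨Function.update (fun j => u (t.succAbove j)) r (u (t.succAbove r) + u t - v), ?_, ?_⟩
  · intro j
    rcases eq_or_ne j r with rfl | hj
    · simpa using h
    · simpa [hj] using hu _
  · rw [Fin.sum_univ_succAbove (fun j => u j - v) t,
      ← Finset.add_sum_erase _ (fun j => u (t.succAbove j) - v) (Finset.mem_univ r),
      ← Finset.add_sum_erase _ _ (Finset.mem_univ r),
      Finset.sum_congr rfl (g := fun j => u (t.succAbove j) - v)]
    · simp only [Function.update_self]
      abel
    · intro j hj
      simp [Finset.ne_of_mem_erase hj]

/-- If any two of at least two real numbers have sum greater than `1`, then their total exceeds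
half their number. -/
theorem card_lt_two_mul_sum_of_one_lt_add {n : ℕ} (c : Fin (n + 2) → ℝ)
    (h : ∀ s t, s ≠ t → 1 < c s + c t) : ((n + 2 : ℕ) : ℝ) < 2 * ∑ j, c j := by
  have hshift : ∑ j, c (j + 1) = ∑ j, c j :=
    Equiv.sum_comp (Equiv.addRight (1 : Fin (n + 2))) c
  calc ((n + 2 : ℕ) : ℝ) = ∑ _j : Fin (n + 2), (1 : ℝ) := by simp
    _ < ∑ j, (c j + c (j + 1)) :=
      Finset.sum_lt_sum_of_nonempty Finset.univ_nonempty fun j _ => h _ _ (by simp)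
    _ = 2 * ∑ j, c j := by rw [Finset.sum_add_distrib, hshift, two_mul]

/-- In a simplex, `p + q - b i` is again a point of the simplex as soon as its `i`-th barycentric
coordinate is nonnegative. -/
theorem AffineBasis.add_sub_mem_convexHull {ι E : Type*} [Finite ι] [AddCommGroup E] [Module ℝ E]
    (b : AffineBasis ι ℝ E) {p q : E} (hp : p ∈ convexHull ℝ (Set.range b))
    (hq : q ∈ convexHull ℝ (Set.range b)) {i : ι} (h : 1 ≤ b.coord i p + b.coord i q) :
    p + q - b i ∈ convexHull ℝ (Set.range b) := by
  rw [b.convexHull_eq_nonneg_coord, Set.mem_ofPred_eq] at *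
  intro j
  have key : b.coord j (p + q - b i) = b.coord j p + b.coord j q - b.coord j (b i) := by
    have := (b.coord j).map_vadd p (q - b i)
    rw [vadd_eq_add, vadd_eq_add, ← vsub_eq_sub q, AffineMap.linearMap_vsub, vsub_eq_sub,
      vsub_eq_sub] at this
    rw [show p + q - b i = q - b i + p by abel, this]
    ring
  rw [key]
  rcases eq_or_ne j i with rfl | hj
  · rw [b.coord_apply_eq]
    linarith
  · rw [b.coord_apply_ne hj]
    linarith [hp j, hq j]

/-- The vertices of a simplex are extreme points. -/
theorem AffineBasis.mem_extremePoints_convexHull {ι E : Type*} [Finite ι] [AddCommGroup E]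
    [Module ℝ E] (b : AffineBasis ι ℝ E) (i : ι) :
    b i ∈ (convexHull ℝ (Set.range b)).extremePoints ℝ := by
  refine mem_extremePoints_iff_left.2 ⟨subset_convexHull ℝ _ (Set.mem_range_self i), ?_⟩
  intro p hp q hq ⟨s, t, hs, ht, hst, hpq⟩
  rw [b.convexHull_eq_nonneg_coord, Set.mem_ofPred_eq] at hp hq
  have hzero : ∀ j, j ≠ i → b.coord j p = 0 := fun j hj => by
    have h := congrArg (b.coord j) hpq
    rw [Convex.combo_affine_apply hst, b.coord_apply_ne hj, smul_eq_mul, smul_eq_mul] at h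
    nlinarith [hp j, mul_nonneg hs.le (hp j), mul_nonneg ht.le (hq j)]
  have := Fintype.ofFinite ι
  refine b.ext_elem fun j => ?_
  rcases eq_or_ne j i with rfl | hj
  · rw [b.coord_apply_eq, ← b.sum_coord_apply_eq_one p]
    exact (Finset.sum_eq_single j (fun l _ hl => hzero l hl) (by simp)).symm
  · rw [hzero j hj, b.coord_apply_ne hj]

/-- Ogata's lemma for very ample lattice simplices. -/
theorem stmt0 {d : ℕ} (v : Fin (d + 1) → Fin d → ℝ)
    (hlat : ∀ i, IsLatticePt (v i)) (hind : AffineIndependent ℝ v)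
    (hva : IsVeryAmple (convexHull ℝ (Set.range v)))
    (k : ℕ) (hk : 1 ≤ k) (x : Fin d → ℝ)
    (hx : x ∈ latticePts ((k : ℝ) • convexHull ℝ (Set.range v)))
    (i : Fin (d + 1)) :
    ∃ u : Fin (2 * k - 1) → Fin d → ℝ,
      (∀ j, u j ∈ latticePts (convexHull ℝ (Set.range v))) ∧
        x + ((k : ℝ) - 1) • v i = ∑ j, u j := by
  obtain ⟨⟨p, hp, rfl⟩, hxlat⟩ := hx
  let b : AffineBasis (Fin (d + 1)) ℝ (Fin d → ℝ) :=
    ⟨v, hind, hind.affineSpan_eq_top_iff_card_eq_finrank_add_one.2 (by simp)⟩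
  have hbP : convexHull ℝ (Set.range b) = convexHull ℝ (Set.range v) := rfl
  have hbv : b i = v i := rfl
  set P := convexHull ℝ (Set.range v)
  have hvi : v i ∈ latticePts P := ⟨subset_convexHull ℝ _ (Set.mem_range_self i), hlat i⟩
  have hrep : ∃ (m : ℕ) (u : Fin m → Fin d → ℝ), (∀ j, u j ∈ latticePts P) ∧
      ∑ j, (u j - v i) = (k : ℝ) • (p - v i) := by
    obtain ⟨m, u, hu, h⟩ := hva (v i) (b.mem_extremePoints_convexHull i) ((k : ℝ) • (p - v i))
      (by rw [smul_sub]; exact hxlat.sub ((hlat i).nsmul k))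
      ⟨k, p - v i, ⟨p, hp, rfl⟩, k.cast_nonneg, rfl⟩
    exact ⟨m, u, hu, h.symm⟩
  classical
  obtain ⟨u, hu, hsum⟩ := Nat.find_spec hrep
  have hmin := fun n => Nat.find_min hrep (m := n)
  generalize Nat.find hrep = m at u hu hsum hmin
  have hm : m ≤ 2 * k - 1 := by
    by_contra! hlt
    obtain ⟨n, rfl⟩ : ∃ n, m = n + 2 := ⟨m - 2, by omega⟩
    have hcoord : ∀ q, (b.coord i).linear (q - v i) = b.coord i q - 1 := fun q => by
      rw [← vsub_eq_sub, AffineMap.linearMap_vsub, ← hbv, b.coord_apply_eq, vsub_eq_sub]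
    have htotal : ∑ j, (1 - b.coord i (u j)) ≤ k := by
      have h := congrArg (b.coord i).linear hsum
      simp only [map_sum, map_smul, hcoord, smul_eq_mul] at h
      have hnonneg : 0 ≤ b.coord i p := by
        rw [← hbP, b.convexHull_eq_nonneg_coord] at hp
        exact hp i
      have hneg : ∑ j, (1 - b.coord i (u j)) = -∑ j, (b.coord i (u j) - 1) := by
        rw [← Finset.sum_neg_distrib]
        simp
      rw [hneg, h]
      nlinarith [(k.cast_nonneg : (0 : ℝ) ≤ k)]
    have hcard := card_lt_two_mul_sum_of_one_lt_add (fun j => 1 - b.coord i (u j)) fun s t hst => by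
      by_contra! hle
      have hmerge : u s + u t - v i ∈ latticePts P :=
        ⟨b.add_sub_mem_convexHull (hu s).1 (hu t).1 (i := i) (by linarith),
          ((hu s).2.add (hu t).2).sub (hlat i)⟩
      obtain ⟨w, hw, hwsum⟩ := exists_sum_sub_eq_of_add_sub_mem hu hst hmerge
      exact hmin (n + 1) (by omega) ⟨w, hw, hwsum.trans hsum⟩
    have : ((n + 2 : ℕ) : ℝ) < ((2 * k : ℕ) : ℝ) := by
      push_cast at hcard ⊢
      linarith
    rw [Nat.cast_lt] at this
    omega
  obtain ⟨r, hr⟩ := Nat.exists_eq_add_of_le hm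
  have hrk : (m : ℝ) + r = 2 * k - 1 := by
    have : m + r + 1 = 2 * k := by omega
    have : (m : ℝ) + r + 1 = 2 * k := by exact_mod_cast this
    linarith
  rw [hr]
  refine ⟨Fin.append u fun _ => v i, fun j => ?_, ?_⟩
  · refine Fin.addCases (fun j => ?_) (fun j => ?_) j
    · simpa using hu j
    · simpa using hvi
  · rw [Finset.sum_sub_distrib, sub_eq_iff_eq_add] at hsum
    simp only [Fin.sum_univ_add, Fin.append_left, Fin.append_right, hsum, Finset.sum_const,
      Finset.card_univ, Fintype.card_fin, ← Nat.cast_smul_eq_nsmul ℝ]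
    rw [show (r : ℝ) = 2 * k - 1 - m by linarith]
    module
end

section
/- Let P = conv(v_0, …, v_d) ⊂ ℝ^d be a very ample lattice d-simplex and let k ≥ 1 be an integer. Then for every lattice point x ∈ kP ∩ M and all nonnegative integers a_0, …, a_d with a_0 + ⋯ + a_d = k − 1, there exist lattice points u_1, …, u_{2k−1} ∈ P ∩ M such that a_0·v_0 + ⋯ + a_d·v_d + x = u_1 + ⋯ + u_{2k−1}. -/
open Set MeasureTheory
open scoped Pointwise

theorem IsLatticePt.natCast_smul {n : ℕ} {x : Fin n → ℝ} (hx : IsLatticePt x) (m : ℕ) :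
    IsLatticePt ((m : ℝ) • x) := fun i => by
  obtain ⟨a, ha⟩ := hx i
  exact ⟨m * a, by simp [ha]⟩

namespace AffineBasis

variable {ι E : Type*} [AddCommGroup E] [Module ℝ E]

/-- The barycentric coordinate of `b` at index `i`, homogenized so that it is linear on the cone
over the simplex: it agrees with `r * b.coord i (r⁻¹ • x)` at every height `r ≠ 0`. -/
noncomputable def homCoord (b : AffineBasis ι ℝ E) (i : ι) (r : ℝ) (x : E) : ℝ :=
  (b.coord i).linear x + r * b.coord i 0

theorem homCoord_one (b : AffineBasis ι ℝ E) (i : ι) (x : E) :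
    b.homCoord i 1 x = b.coord i x := by
  rw [homCoord, one_mul]
  exact (congrFun (b.coord i).decomp x).symm

theorem homCoord_smul (b : AffineBasis ι ℝ E) (i : ι) (r s : ℝ) (x : E) :
    b.homCoord i (s * r) (s • x) = s * b.homCoord i r x := by
  simp only [homCoord, map_smul, smul_eq_mul]
  ring

theorem homCoord_add (b : AffineBasis ι ℝ E) (i : ι) (r s : ℝ) (x y : E) :
    b.homCoord i (r + s) (x + y) = b.homCoord i r x + b.homCoord i s y := by
  simp only [homCoord, map_add]
  ring

theorem homCoord_sub (b : AffineBasis ι ℝ E) (i : ι) (r s : ℝ) (x y : E) :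
    b.homCoord i (r - s) (x - y) = b.homCoord i r x - b.homCoord i s y := by
  simp only [homCoord, map_sub]
  ring

theorem mem_smul_convexHull_iff [Finite ι] (b : AffineBasis ι ℝ E) {r : ℝ} (hr : 0 < r) (x : E) :
    x ∈ r • convexHull ℝ (Set.range b) ↔ ∀ i, 0 ≤ b.homCoord i r x := by
  rw [Set.mem_smul_set_iff_inv_smul_mem₀ hr.ne', b.convexHull_eq_nonneg_coord, Set.mem_ofPred_eq]
  refine forall_congr' fun i => ?_
  rw [← b.homCoord_one, ← inv_mul_cancel₀ hr.ne', b.homCoord_smul]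
  exact mul_nonneg_iff_of_pos_left (inv_pos.mpr hr)

theorem mem_convexHull_iff [Finite ι] (b : AffineBasis ι ℝ E) (x : E) :
    x ∈ convexHull ℝ (Set.range b) ↔ ∀ i, 0 ≤ b.homCoord i 1 x := by
  simpa using b.mem_smul_convexHull_iff one_pos x

theorem mem_extremePoints_convexHull_s1 [Finite ι] (b : AffineBasis ι ℝ E) (i : ι) :
    b i ∈ (convexHull ℝ (Set.range b)).extremePoints ℝ := by
  rw [mem_extremePoints]
  refine ⟨subset_convexHull ℝ _ ⟨i, rfl⟩, fun p hp q hq hpq => ?_⟩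
  obtain ⟨s, t, hs, ht, hst, hpq⟩ := hpq
  have hp' := (b.mem_convexHull_iff p).1 hp
  have hq' := (b.mem_convexHull_iff q).1 hq
  have hzero : ∀ j, j ≠ i → b.coord j p = 0 ∧ b.coord j q = 0 := fun j hj => by
    have h : b.homCoord j (s * 1 + t * 1) (s • p + t • q) = 0 := by
      rw [mul_one, mul_one, hst, hpq, b.homCoord_one, b.coord_apply_ne hj]
    rw [b.homCoord_add, b.homCoord_smul, b.homCoord_smul] at h
    have h₁ := mul_nonneg hs.le (hp' j)
    have h₂ := mul_nonneg ht.le (hq' j)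
    rw [← b.homCoord_one, ← b.homCoord_one]
    constructor
    · exact (mul_eq_zero.1 (by linarith)).resolve_left hs.ne'
    · exact (mul_eq_zero.1 (by linarith)).resolve_left ht.ne'
  have heq : ∀ y, (∀ j, j ≠ i → b.coord j y = 0) → y = b i := fun y hy => by
    have := Fintype.ofFinite ι
    refine b.ext_elem fun j => ?_
    rcases eq_or_ne j i with rfl | hj
    · have h := b.sum_coord_apply_eq_one y
      rw [Finset.sum_eq_single j (fun k _ hk => hy k hk) (by simp)] at h
      rw [h, b.coord_apply_eq]
    · rw [hy j hj, b.coord_apply_ne hj]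
  exact ⟨heq p fun j hj => (hzero j hj).1, heq q fun j hj => (hzero j hj).2⟩

theorem homCoord_nonneg_of_multiset_sum (b : AffineBasis ι ℝ E) {i j : ι} (hij : i ≠ j)
    (s : Multiset E) (hs : ∀ u ∈ s, 0 ≤ b.homCoord i 1 u) :
    0 ≤ b.homCoord i 0 (s.map (· - b j)).sum := by
  induction s using Multiset.induction with
  | empty => simp [homCoord]
  | cons u s ih =>
    have h := b.homCoord_sub i 1 1 u (b j)
    rw [b.homCoord_one i (b j), b.coord_apply_ne hij, sub_self] at h
    rw [Multiset.map_cons, Multiset.sum_cons, ← add_zero (0 : ℝ), b.homCoord_add, h, add_zero,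
      sub_zero]
    exact add_nonneg (hs u (by simp)) (ih fun w hw => hs w (by simp [hw]))

end AffineBasis

/-- If a lattice point `x` of `(k + 2)P` is reachable from the vertex `b i` by lattice points
of `P`, then adding that vertex lets two lattice points of `P` be split off from `x`. -/
theorem exists_add_vertex_eq_of_multiset {d : ℕ} {ι : Type*} [Finite ι]
    (b : AffineBasis ι ℝ (Fin d → ℝ))
    (hlat : ∀ i, IsLatticePt (b i)) (i : ι) (k : ℕ) (x : Fin d → ℝ)
    (hx : x ∈ latticePts (((k + 2 : ℕ) : ℝ) • convexHull ℝ (Set.range b)))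
    (s : Multiset (Fin d → ℝ)) (hs : ∀ u ∈ s, u ∈ latticePts (convexHull ℝ (Set.range b)))
    (hxs : x - ((k + 2 : ℕ) : ℝ) • b i = (s.map (· - b i)).sum) :
    ∃ y ∈ latticePts (((k + 1 : ℕ) : ℝ) • convexHull ℝ (Set.range b)),
      ∃ u ∈ latticePts (convexHull ℝ (Set.range b)),
      ∃ w ∈ latticePts (convexHull ℝ (Set.range b)), x + b i = y + u + w := by
  have hbi : b i ∈ latticePts (convexHull ℝ (Set.range b)) :=
    ⟨subset_convexHull ℝ _ ⟨i, rfl⟩, hlat i⟩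
  have hmul : ((k + 1 : ℕ) : ℝ) • b i ∈
      latticePts (((k + 1 : ℕ) : ℝ) • convexHull ℝ (Set.range b)) :=
    ⟨Set.smul_mem_smul_set hbi.1, (hlat i).natCast_smul _⟩
  induction hn : s.card generalizing s with
  | zero =>
    rw [Multiset.card_eq_zero] at hn
    subst hn
    refine ⟨_, hmul, _, hbi, _, hbi, ?_⟩
    rw [Multiset.map_zero, Multiset.sum_zero, sub_eq_zero] at hxs
    rw [hxs]
    push_cast
    module
  | succ n ih =>
    obtain ⟨u, hus⟩ := Multiset.exists_mem_of_ne_zero (s := s) (by rintro rfl; simp at hn)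
    obtain ⟨t, rfl⟩ := Multiset.exists_cons_of_mem hus
    have hu := hs u (by simp)
    rcases Multiset.empty_or_exists_mem t with rfl | ⟨w, hwt⟩
    · refine ⟨_, hmul, u, hu, _, hbi, ?_⟩
      rw [sub_eq_iff_eq_add] at hxs
      rw [hxs]
      simp only [Multiset.map_cons, Multiset.map_zero, Multiset.sum_cons, Multiset.sum_zero]
      push_cast
      module
    obtain ⟨t, rfl⟩ := Multiset.exists_cons_of_mem hwt
    have hw := hs w (by simp)
    have hu' := (b.mem_convexHull_iff u).1 hu.1
    have hw' := (b.mem_convexHull_iff w).1 hw.1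
    have hone : ∀ j, b.homCoord j 1 (u + w - b i) =
        b.homCoord j 1 u + b.homCoord j 1 w - b.homCoord j 1 (b i) := fun j => by
      rw [← b.homCoord_add, ← b.homCoord_sub]
      norm_num
    rcases le_or_gt 1 (b.homCoord i 1 u + b.homCoord i 1 w) with hge | hlt
    · refine ih ((u + w - b i) ::ₘ t) ?_ ?_ ?_
      · intro z hz
        rcases Multiset.mem_cons.1 hz with rfl | hz
        · refine ⟨(b.mem_convexHull_iff _).2 fun j => ?_, (hu.2.add hw.2).sub (hlat i)⟩
          rw [hone, b.homCoord_one j (b i)]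
          rcases eq_or_ne j i with rfl | hj
          · rw [b.coord_apply_eq]
            linarith
          · rw [b.coord_apply_ne hj]
            linarith [hu' j, hw' j]
        · exact hs z (by simp [hz])
      · rw [hxs]
        simp only [Multiset.map_cons, Multiset.sum_cons]
        abel
      · simpa using hn
    · refine ⟨x - (u + w - b i), ⟨?_, hx.2.sub ((hu.2.add hw.2).sub (hlat i))⟩,
        u, hu, w, hw, by abel⟩
      rw [b.mem_smul_convexHull_iff (by positivity)]
      intro j
      rcases eq_or_ne j i with rfl | hj
      · have h : ((k + 1 : ℕ) : ℝ) = ((k + 2 : ℕ) : ℝ) - 1 := by push_cast; ring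
        rw [h, b.homCoord_sub, hone, b.homCoord_one j (b j), b.coord_apply_eq]
        have := (b.mem_smul_convexHull_iff (by positivity) x).1 hx.1 j
        linarith
      · have ht := b.homCoord_nonneg_of_multiset_sum hj t fun z hz =>
          (b.mem_convexHull_iff z).1 (hs z (by simp [hz])).1 j
        have h₀ : x - (u + w - b i) =
            ((k + 1 : ℕ) : ℝ) • b i + (t.map (· - b i)).sum := by
          rw [sub_eq_iff_eq_add] at hxs
          rw [hxs]
          simp only [Multiset.map_cons, Multiset.sum_cons]
          push_cast
          module
        have h₁ := b.homCoord_smul j 1 ((k + 1 : ℕ) : ℝ) (b i)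
        rw [b.homCoord_one, b.coord_apply_ne hj, mul_one, mul_zero] at h₁
        rw [h₀, ← add_zero ((k + 1 : ℕ) : ℝ), b.homCoord_add, add_zero, h₁, zero_add]
        exact ht

theorem IsVeryAmple.exists_add_vertex_eq {d : ℕ} {ι : Type*} [Finite ι]
    {b : AffineBasis ι ℝ (Fin d → ℝ)} (hva : IsVeryAmple (convexHull ℝ (Set.range b)))
    (hlat : ∀ i, IsLatticePt (b i)) (i : ι) (k : ℕ) (x : Fin d → ℝ)
    (hx : x ∈ latticePts (((k + 2 : ℕ) : ℝ) • convexHull ℝ (Set.range b))) :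
    ∃ y ∈ latticePts (((k + 1 : ℕ) : ℝ) • convexHull ℝ (Set.range b)),
      ∃ u ∈ latticePts (convexHull ℝ (Set.range b)),
      ∃ w ∈ latticePts (convexHull ℝ (Set.range b)), x + b i = y + u + w := by
  obtain ⟨p, hp, hpx⟩ := hx.1
  obtain ⟨m, u, hu, hxu⟩ := hva (b i) (b.mem_extremePoints_convexHull_s1 i)
    (x - ((k + 2 : ℕ) : ℝ) • b i) (hx.2.sub ((hlat i).natCast_smul _))
    ⟨((k + 2 : ℕ) : ℝ), p - b i, ⟨p, hp, rfl⟩, by positivity, by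
      rw [← hpx, smul_sub]⟩
  refine exists_add_vertex_eq_of_multiset b hlat i k x hx (Finset.univ.val.map u) ?_ ?_
  · simpa using hu
  · rw [hxu, Multiset.map_map]
    rfl

theorem IsVeryAmple.exists_multiset_sum_eq {d : ℕ} {ι : Type*} [Fintype ι]
    {b : AffineBasis ι ℝ (Fin d → ℝ)} (hva : IsVeryAmple (convexHull ℝ (Set.range b)))
    (hlat : ∀ i, IsLatticePt (b i)) (k : ℕ) (x : Fin d → ℝ)
    (hx : x ∈ latticePts (((k + 1 : ℕ) : ℝ) • convexHull ℝ (Set.range b)))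
    (a : ι → ℕ) (ha : ∑ i, a i = k) :
    ∃ s : Multiset (Fin d → ℝ), s.card = 2 * k + 1 ∧
      (∀ u ∈ s, u ∈ latticePts (convexHull ℝ (Set.range b))) ∧
        (∑ i, (a i : ℝ) • b i) + x = s.sum := by
  classical
  induction k generalizing x a with
  | zero =>
    refine ⟨{x}, by simp, by simpa using hx, ?_⟩
    have ha' : ∀ i, a i = 0 := by simpa using ha
    simp [ha']
  | succ k ih =>
    obtain ⟨i, -, hi⟩ := Finset.exists_ne_zero_of_sum_ne_zero (ha.trans_ne k.succ_ne_zero)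
    have hsplit : ∀ j, a j = Function.update a i (a i - 1) j + if j = i then 1 else 0 := by
      intro j
      rcases eq_or_ne j i with rfl | hj
      · simp only [Function.update_self, if_true]
        omega
      · simp [hj]
    obtain ⟨y, hy, u, hu, w, hw, hxy⟩ := hva.exists_add_vertex_eq hlat i k x hx
    obtain ⟨s, hcard, hs, hsum⟩ := ih y hy (Function.update a i (a i - 1)) (by
      rw [Finset.sum_congr rfl fun j _ => hsplit j, Finset.sum_add_distrib] at ha
      simpa using ha)
    refine ⟨u ::ₘ w ::ₘ s, by simp [hcard]; ring, ?_, ?_⟩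
    · intro z hz
      simp only [Multiset.mem_cons] at hz
      rcases hz with rfl | rfl | hz
      exacts [hu, hw, hs z hz]
    · have h : ∑ j, (a j : ℝ) • b j =
          ∑ j, (Function.update a i (a i - 1) j : ℝ) • b j + b i := by
        rw [Finset.sum_congr rfl fun j _ => by rw [hsplit j]]
        simp [add_smul, Finset.sum_add_distrib]
      rw [Multiset.sum_cons, Multiset.sum_cons, ← hsum, h, add_assoc, add_comm (b i), hxy]
      abel

/-- generalized Ogata lemma. -/
theorem stmt1 {d : ℕ} (v : Fin (d + 1) → Fin d → ℝ)
    (hlat : ∀ i, IsLatticePt (v i)) (hind : AffineIndependent ℝ v)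
    (hva : IsVeryAmple (convexHull ℝ (Set.range v)))
    (k : ℕ) (hk : 1 ≤ k) (x : Fin d → ℝ)
    (hx : x ∈ latticePts ((k : ℝ) • convexHull ℝ (Set.range v)))
    (a : Fin (d + 1) → ℕ) (ha : ∑ i, a i = k - 1) :
    ∃ u : Fin (2 * k - 1) → Fin d → ℝ,
      (∀ j, u j ∈ latticePts (convexHull ℝ (Set.range v))) ∧
        (∑ i, (a i : ℝ) • v i) + x = ∑ j, u j := by
  obtain ⟨k, rfl⟩ : ∃ m, k = m + 1 := ⟨k - 1, by omega⟩
  let b : AffineBasis (Fin (d + 1)) ℝ (Fin d → ℝ) :=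
    ⟨v, hind, (hind.affineSpan_eq_top_iff_card_eq_finrank_add_one).2 (by simp)⟩
  obtain ⟨s, hcard, hs, hsum⟩ :=
    IsVeryAmple.exists_multiset_sum_eq (b := b) hva hlat k x hx a (by simpa using ha)
  obtain ⟨l, rfl⟩ := Quot.exists_rep s
  have hlen : 2 * (k + 1) - 1 = l.length := by
    have : l.length = 2 * k + 1 := hcard
    omega
  rw [hlen]
  refine ⟨fun j => l[j], fun j => hs _ (List.getElem_mem j.2), ?_⟩
  exact hsum.trans (Fin.sum_univ_getElem l).symm
end

section
/- Let P = conv(v_0, …, v_d) ⊂ ℝ^d be a very ample lattice d-simplex. Then k_P ≤ ν_P + d_P − 1. -/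
open Set MeasureTheory
open scoped Pointwise

section LatticeWeights

lemma single_le_of_one_le {ι : Type*} [DecidableEq ι] {x : ι → ℝ} (hx : 0 ≤ x) {i : ι} (hi : 1 ≤ x i) :
    Pi.single i 1 ≤ x := by
  intro j
  rcases eq_or_ne j i with rfl | hj
  · simpa using hi
  · simpa [hj] using hx j

variable {ι : Type*} [Fintype ι]

/-- The nonnegative weight vectors of total weight `k` that lie in the group `L`. -/
def latticeWeights (L : AddSubgroup (ι → ℝ)) (k : ℕ) : Set (ι → ℝ) :=
  {w | 0 ≤ w ∧ ∑ i, w i = k ∧ w ∈ L}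

/-- The vertices of the standard simplex. -/
def unitWeights (ι : Type*) [DecidableEq ι] : Set (ι → ℝ) :=
  Set.range fun i => Pi.single i 1

variable {L : AddSubgroup (ι → ℝ)}

lemma add_mem_latticeWeights {k l : ℕ} {x y : ι → ℝ} (hx : x ∈ latticeWeights L k)
    (hy : y ∈ latticeWeights L l) : x + y ∈ latticeWeights L (k + l) := by
  refine ⟨add_nonneg hx.1 hy.1, ?_, L.add_mem hx.2.2 hy.2.2⟩
  simp [Finset.sum_add_distrib, hx.2.1, hy.2.1]

lemma sub_mem_latticeWeights {k l : ℕ} {x y : ι → ℝ} (hx : x ∈ latticeWeights L (k + l))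
    (hy : y ∈ latticeWeights L l) (hyx : y ≤ x) : x - y ∈ latticeWeights L k := by
  refine ⟨sub_nonneg.2 hyx, ?_, L.sub_mem hx.2.2 hy.2.2⟩
  simp [Finset.sum_sub_distrib, hx.2.1, hy.2.1]

lemma zero_mem_latticeWeights : (0 : ι → ℝ) ∈ latticeWeights L 0 :=
  ⟨le_rfl, by simp, L.zero_mem⟩

lemma eq_zero_of_mem_latticeWeights_zero {x : ι → ℝ} (hx : x ∈ latticeWeights L 0) : x = 0 := by
  have h := hx.2.1
  rw [Nat.cast_zero, Finset.sum_eq_zero_iff_of_nonneg fun i _ => hx.1 i] at h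
  exact funext fun i => h i (Finset.mem_univ i)

lemma nsmul_latticeWeights_one_subset (k : ℕ) :
    k • latticeWeights L 1 ⊆ latticeWeights L k := by
  induction k with
  | zero =>
    rw [zero_nsmul]
    rintro x rfl
    exact zero_mem_latticeWeights
  | succ k ih =>
    rw [succ_nsmul]
    rintro _ ⟨x, hx, y, hy, rfl⟩
    exact add_mem_latticeWeights (ih hx) hy

/-- If passing from level `k` to level `k + 1` only requires adding elements of `A` for all
`k ≥ m`, then passing from level `m` to level `m + n` only requires sums of `n` elements of `A`. -/
lemma latticeWeights_add_subset {A : Set (ι → ℝ)} {m : ℕ}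
    (h : ∀ k, m ≤ k → latticeWeights L (k + 1) ⊆ A + latticeWeights L k) (n : ℕ) :
    latticeWeights L (m + n) ⊆ n • A + latticeWeights L m := by
  induction n with
  | zero => simp
  | succ n ih =>
    refine (h (m + n) (by omega)).trans ?_
    rw [succ_nsmul', add_assoc]
    exact Set.add_subset_add_left ih

variable [DecidableEq ι]

lemma single_mem_latticeWeights (hL : unitWeights ι ⊆ L) (i : ι) :
    Pi.single i 1 ∈ latticeWeights L 1 :=
  ⟨Pi.single_nonneg.2 zero_le_one, by simp, hL ⟨i, rfl⟩⟩

lemma unitWeights_subset_latticeWeights (hL : unitWeights ι ⊆ L) :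
    unitWeights ι ⊆ latticeWeights L 1 := by
  rintro _ ⟨i, rfl⟩
  exact single_mem_latticeWeights hL i

/-- If `z` becomes a sum of weights of level one after adding copies of a vertex, then after
adding a single copy one can already split off two weights of level one. -/
lemma exists_add_single_eq (hL : unitWeights ι ⊆ L) {e : ℕ} {z : ι → ℝ}
    (hz : z ∈ latticeWeights L (e + 2)) (i : ι) (a : ℕ)
    (ha : z + a • Pi.single i 1 ∈ (e + 2 + a) • latticeWeights L 1) :
    ∃ u ∈ latticeWeights L 1, ∃ u' ∈ latticeWeights L 1, ∃ y ∈ latticeWeights L (e + 1),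
      z + Pi.single i 1 = u + u' + y := by
  induction a with
  | zero =>
    rw [zero_smul, add_zero, add_zero, succ_nsmul] at ha
    obtain ⟨r, hr, u, hu, rfl⟩ := ha
    exact ⟨u, hu, _, single_mem_latticeWeights hL i, r, nsmul_latticeWeights_one_subset _ hr,
      by simp only; abel⟩
  | succ a ih =>
    obtain ⟨s, ⟨r, hr, u, hu, rfl⟩, u', hu', h⟩ :
        z + (a + 1) • Pi.single i 1 ∈
          (e + 1 + a) • latticeWeights L 1 + latticeWeights L 1 + latticeWeights L 1 := by
      rw [← succ_nsmul, ← succ_nsmul]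
      convert! ha using 2
      omega
    simp only at h
    have huu := add_mem_latticeWeights hu hu'
    by_cases hi : 1 ≤ (u + u') i
    · refine ih ?_
      have hw := sub_mem_latticeWeights huu (single_mem_latticeWeights hL i)
        (single_le_of_one_le huu.1 hi)
      rw [show e + 2 + a = e + 1 + a + 1 by omega, succ_nsmul]
      refine ⟨r, hr, _, hw, ?_⟩
      rw [succ_nsmul] at h
      simp only
      rw [← add_sub_assoc, ← add_assoc, h]
      abel
    · push Not at hi
      have hr' := nsmul_latticeWeights_one_subset _ hr
      have hz' := add_mem_latticeWeights hz (single_mem_latticeWeights hL i)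
      refine ⟨u, hu, u', hu', _, sub_mem_latticeWeights (l := 2) hz' huu ?_, by abel⟩
      intro j
      rcases eq_or_ne j i with rfl | hj
      · have := hz.1 j
        simp only [Pi.add_apply, Pi.single_eq_same, Pi.zero_apply] at hi this ⊢
        linarith
      · have := congrFun h j
        have := hr'.1 j
        simp_all
        linarith

/-- If every weight of every level becomes a sum of weights of level one after adding copies
of any vertex, then adding `e` vertices to a weight of level `e + 1` suffices. -/
lemma add_mem_nsmul_latticeWeights (hL : unitWeights ι ⊆ L)
    (hva : ∀ i, ∀ k, ∀ z ∈ latticeWeights L k,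
      ∃ a : ℕ, z + a • Pi.single i 1 ∈ (k + a) • latticeWeights L 1)
    {e : ℕ} {z w : ι → ℝ} (hz : z ∈ latticeWeights L (e + 1)) (hw : w ∈ e • unitWeights ι) :
    z + w ∈ (e + 1 + e) • latticeWeights L 1 := by
  induction e generalizing z w with
  | zero =>
    rw [zero_nsmul] at hw
    obtain rfl : w = 0 := hw
    simpa using hz
  | succ e ih =>
    rw [succ_nsmul] at hw
    obtain ⟨w, hw, _, ⟨i, rfl⟩, rfl⟩ := hw
    obtain ⟨a, ha⟩ := hva i _ z hz
    obtain ⟨u, hu, u', hu', y, hy, h⟩ := exists_add_single_eq hL hz i a ha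
    rw [show e + 1 + 1 + (e + 1) = e + 1 + e + 1 + 1 by omega, succ_nsmul, succ_nsmul]
    refine ⟨_, ⟨_, ih hy hw, u, hu, rfl⟩, u', hu', ?_⟩
    simp only
    rw [add_comm w, ← add_assoc z, h]
    abel

/-- A weight of large level is a vertex plus a weight. -/
lemma latticeWeights_succ_subset (hL : unitWeights ι ⊆ L) {k : ℕ} (hk : Fintype.card ι ≤ k) :
    latticeWeights L (k + 1) ⊆ unitWeights ι + latticeWeights L k := by
  intro x hx
  obtain ⟨i, hi⟩ : ∃ i, 1 ≤ x i := by
    by_contra! h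
    have h1 : ∑ i, x i ≤ ∑ _i : ι, (1 : ℝ) := Finset.sum_le_sum fun i _ => (h i).le
    have h2 : (Fintype.card ι : ℝ) ≤ k := by exact_mod_cast hk
    rw [hx.2.1] at h1
    simp at h1
    linarith
  exact ⟨_, ⟨i, rfl⟩, _, sub_mem_latticeWeights hx (single_mem_latticeWeights hL i)
    (single_le_of_one_le hx.1 hi), by simp⟩

lemma latticeWeights_subset_nsmul (hL : unitWeights ι ⊆ L)
    (hva : ∀ i, ∀ k, ∀ z ∈ latticeWeights L k,
      ∃ a : ℕ, z + a • Pi.single i 1 ∈ (k + a) • latticeWeights L 1)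
    {e n k : ℕ} (hen : e + 1 ≤ n) (hk : n + e ≤ k)
    (he : ∀ m, e + 1 ≤ m → latticeWeights L (m + 1) ⊆ latticeWeights L 1 + latticeWeights L m)
    (hn : ∀ m, n ≤ m → latticeWeights L (m + 1) ⊆ unitWeights ι + latticeWeights L m) :
    latticeWeights L k ⊆ k • latticeWeights L 1 := by
  obtain ⟨p, rfl⟩ := Nat.exists_eq_add_of_le hen
  obtain ⟨q, rfl⟩ := Nat.exists_eq_add_of_le hk
  intro x hx
  rw [add_assoc (e + 1 + p)] at hx
  obtain ⟨w, hw, y, hy, rfl⟩ := latticeWeights_add_subset hn _ hx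
  obtain ⟨s, hs, z, hz, rfl⟩ := latticeWeights_add_subset he _ hy
  rw [add_nsmul] at hw
  obtain ⟨w, hw, w', hw', rfl⟩ := hw
  have h := add_mem_nsmul_latticeWeights hL hva hz hw
  have hq := Set.nsmul_subset_nsmul_left (n := q) (unitWeights_subset_latticeWeights hL) hw'
  rw [show e + 1 + p + e + q = (e + 1 + e) + p + q by omega, add_nsmul, add_nsmul]
  exact ⟨_, ⟨_, h, s, hs, rfl⟩, w', hq, by simp only; abel⟩

end LatticeWeights

section Simplex

variable {d : ℕ}

/-- The group of lattice points of `ℝ^n`. -/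
def latticeGroup (n : ℕ) : AddSubgroup (Fin n → ℝ) where
  carrier := {x | IsLatticePt x}
  zero_mem' := fun _ => ⟨0, by simp⟩
  add_mem' := fun {x y} hx hy i => by
    obtain ⟨a, ha⟩ := hx i
    obtain ⟨b, hb⟩ := hy i
    exact ⟨a + b, by simp [ha, hb]⟩
  neg_mem' := fun {x} hx i => by
    obtain ⟨a, ha⟩ := hx i
    exact ⟨-a, by simp [ha]⟩

/-- The weight vectors whose linear combination of the `v i` is a lattice point. -/
def weightGroup (v : Fin (d + 1) → Fin d → ℝ) : AddSubgroup (Fin (d + 1) → ℝ) :=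
  (latticeGroup d).comap (Fintype.linearCombination ℝ v).toAddMonoidHom

variable {v : Fin (d + 1) → Fin d → ℝ}

local notation "φ" => Fintype.linearCombination ℝ v
local notation "B" => latticeWeights (weightGroup v)

lemma unitWeights_subset_weightGroup (hlat : ∀ i, IsLatticePt (v i)) :
    unitWeights (Fin (d + 1)) ⊆ weightGroup v := by
  rintro _ ⟨i, rfl⟩
  change IsLatticePt (φ (Pi.single i 1))
  simpa using hlat i

lemma image_unitWeights : φ '' unitWeights (Fin (d + 1)) = Set.range v := by
  rw [unitWeights, ← Set.range_comp]
  congr 1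
  ext1 i
  simp

lemma image_stdSimplex :
    φ '' stdSimplex ℝ (Fin (d + 1)) = convexHull ℝ (Set.range v) := by
  rw [← image_unitWeights, ← LinearMap.image_convexHull, unitWeights,
    convexHull_rangle_single_eq_stdSimplex]

lemma AffineIndependent.linearCombination_inj (hind : AffineIndependent ℝ v)
    {x y : Fin (d + 1) → ℝ} (hs : ∑ i, x i = ∑ i, y i) (h : φ x = φ y) : x = y := by
  funext i
  refine sub_eq_zero.1 (affineIndependent_iff.1 hind Finset.univ (x - y) ?_ ?_ i
    (Finset.mem_univ i))
  · simp [hs]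
  · rw [← Fintype.linearCombination_apply, map_sub, h, sub_self]

lemma image_latticeWeights (k : ℕ) :
    φ '' B k = latticePts ((k : ℝ) • convexHull ℝ (Set.range v)) := by
  rw [← image_stdSimplex]
  ext x
  constructor
  · rintro ⟨w, hw, rfl⟩
    refine ⟨?_, hw.2.2⟩
    rcases eq_or_ne k 0 with rfl | hk
    · rw [eq_zero_of_mem_latticeWeights_zero hw, map_zero, Nat.cast_zero, Set.zero_smul_set]
      · rfl
      · exact Set.Nonempty.image _ ⟨_, single_mem_stdSimplex ℝ (0 : Fin (d + 1))⟩
    · have hk' : (k : ℝ) ≠ 0 := by exact_mod_cast hk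
      refine ⟨_, ⟨(k : ℝ)⁻¹ • w, ⟨fun i => ?_, ?_⟩, rfl⟩, ?_⟩
      · exact mul_nonneg (by positivity) (hw.1 i)
      · simp [← Finset.mul_sum, hw.2.1, hk']
      · simp [map_smul, smul_smul, hk']
  · rintro ⟨⟨_, ⟨w, hw, rfl⟩, rfl⟩, hx⟩
    refine ⟨(k : ℝ) • w, ⟨fun i => mul_nonneg (by positivity) (hw.1 i), ?_, ?_⟩, map_smul _ _ _⟩
    · simp [← Finset.mul_sum, hw.2]
    · change IsLatticePt (φ _)
      rwa [map_smul]

lemma image_latticeWeights_one :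
    φ '' B 1 = latticePts (convexHull ℝ (Set.range v)) := by
  simpa using image_latticeWeights (v := v) 1

lemma mem_extremePoints_of_affineIndependent (hind : AffineIndependent ℝ v) (i : Fin (d + 1)) :
    v i ∈ (convexHull ℝ (Set.range v)).extremePoints ℝ := by
  refine ⟨subset_convexHull ℝ _ ⟨i, rfl⟩, ?_⟩
  rw [← image_stdSimplex]
  rintro _ ⟨x, hx, rfl⟩ _ ⟨y, hy, rfl⟩ ⟨a, b, ha, hb, hab, h⟩
  have key : a • x + b • y = Pi.single i 1 := by
    refine hind.linearCombination_inj ?_ ?_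
    · simp [Finset.sum_add_distrib, ← Finset.mul_sum, hx.2, hy.2, hab]
    · simpa using h
  have hxs : x = x i • Pi.single i 1 := by
    funext j
    rcases eq_or_ne j i with rfl | hj
    · simp
    · have h0 := congrFun key j
      simp only [Pi.add_apply, Pi.smul_apply, smul_eq_mul, Pi.single_apply, hj, if_false] at h0
      have hxj := mul_nonneg ha.le (hx.1 j)
      have hyj := mul_nonneg hb.le (hy.1 j)
      have : a * x j = 0 := by linarith
      simpa [hj, ha.ne'] using this
  have hxi : x i = 1 := by
    have := hx.2
    rw [hxs] at this
    simpa [← Finset.mul_sum] using this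
  rw [hxs, hxi]
  simp

/-- The statement that level `k + 1` is generated from level `k` by `A`, in terms of weights. -/
lemma latticePts_succ_eq_iff (hind : AffineIndependent ℝ v) {A : Set (Fin (d + 1) → ℝ)}
    (hA : A ⊆ B 1) (k : ℕ) :
    latticePts (((k : ℝ) + 1) • convexHull ℝ (Set.range v)) =
        φ '' A + latticePts ((k : ℝ) • convexHull ℝ (Set.range v)) ↔
      B (k + 1) ⊆ A + B k := by
  have hsub : A + B k ⊆ B (k + 1) := by
    rintro _ ⟨x, hx, y, hy, rfl⟩
    simp only
    rw [add_comm k]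
    exact add_mem_latticeWeights (hA hx) hy
  rw [← Nat.cast_succ, ← image_latticeWeights, ← image_latticeWeights, ← Set.image_add]
  have hinj : Set.InjOn φ (B (k + 1)) := fun x hx y hy h =>
    hind.linearCombination_inj (hx.2.1.trans hy.2.1.symm) h
  rw [hinj.image_eq_image_iff subset_rfl hsub]
  exact ⟨fun h => h.subset, fun h => h.antisymm hsub⟩

lemma exists_add_nsmul_single_mem (hlat : ∀ i, IsLatticePt (v i)) (hind : AffineIndependent ℝ v)
    (hva : IsVeryAmple (convexHull ℝ (Set.range v))) (i : Fin (d + 1)) (k : ℕ)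
    {z : Fin (d + 1) → ℝ} (hz : z ∈ B k) :
    ∃ a : ℕ, z + a • Pi.single i 1 ∈ (k + a) • B 1 := by
  have hL := unitWeights_subset_weightGroup hlat
  obtain ⟨hzP, hzL⟩ : φ z ∈ latticePts ((k : ℝ) • convexHull ℝ (Set.range v)) :=
    image_latticeWeights (v := v) k ▸ Set.mem_image_of_mem _ hz
  obtain ⟨p, hp, hpz⟩ := hzP
  obtain ⟨m, u, hu, h⟩ := hva (v i) (mem_extremePoints_of_affineIndependent hind i)
    (φ z - k • v i) ((latticeGroup d).sub_mem hzL ((latticeGroup d).nsmul_mem (hlat i) k))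
    ⟨k, _, Set.mem_image_of_mem _ hp, by positivity, by
      rw [← hpz]; simp [smul_sub, Nat.cast_smul_eq_nsmul]⟩
  simp only [← image_latticeWeights_one] at hu
  choose y hy hyu using hu
  refine ⟨m, ?_⟩
  have hsum : ∑ j, y j ∈ m • B 1 := Set.mem_nsmul_iff_sum.2 ⟨y, hy, rfl⟩
  have hi : k • (Pi.single i 1 : Fin (d + 1) → ℝ) ∈ k • B 1 :=
    Set.nsmul_mem_nsmul (single_mem_latticeWeights hL i)
  have hmem : ∑ j, y j + k • Pi.single i 1 ∈ (k + m) • B 1 := by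
    rw [add_comm k, add_nsmul]
    exact Set.add_mem_add hsum hi
  convert! hmem using 1
  refine hind.linearCombination_inj ?_ ?_
  · rw [(nsmul_latticeWeights_one_subset _ hmem).2.1]
    simp [Finset.sum_add_distrib, hz.2.1, ← Finset.mul_sum]
  · have hv : φ (Pi.single i 1) = v i := by simp
    rw [map_add, map_add, map_nsmul, map_nsmul, map_sum, hv]
    simp only [hyu]
    rw [Finset.sum_sub_distrib] at h
    simp only [Finset.sum_const, Finset.card_univ, Fintype.card_fin] at h
    rw [sub_eq_sub_iff_add_eq_add] at h
    exact h

lemma isKNormal_of_latticeWeights_subset {k : ℕ} (h : B k ⊆ k • B 1) :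
    IsKNormal (convexHull ℝ (Set.range v)) k := by
  intro x hx
  rw [← image_latticeWeights] at hx
  obtain ⟨w, hw, rfl⟩ := hx
  obtain ⟨f, hf, rfl⟩ := Set.mem_nsmul_iff_sum.1 (h hw)
  refine ⟨fun j => φ (f j), fun j => ?_, map_sum _ _ _⟩
  rw [← image_latticeWeights_one]
  exact Set.mem_image_of_mem _ (hf j)

end Simplex

/-- `k_P ≤ ν_P + d_P - 1` for very ample simplices. -/
theorem stmt2 {d : ℕ} (v : Fin (d + 1) → Fin d → ℝ)
    (hlat : ∀ i, IsLatticePt (v i)) (hind : AffineIndependent ℝ v)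
    (hva : IsVeryAmple (convexHull ℝ (Set.range v))) :
    kNormality (convexHull ℝ (Set.range v)) ≤
      nuInv (Set.range v) (convexHull ℝ (Set.range v)) +
        dInv (convexHull ℝ (Set.range v)) - 1 := by
  have hL := unitWeights_subset_weightGroup hlat
  have hE := unitWeights_subset_latticeWeights hL
  have hnu := latticePts_succ_eq_iff hind hE
  have hd := latticePts_succ_eq_iff hind (subset_refl (latticeWeights (weightGroup v) 1))
  rw [image_unitWeights] at hnu
  rw [image_latticeWeights_one] at hd
  have hnu_mem : nuInv (Set.range v) (convexHull ℝ (Set.range v)) ∈ _ :=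
    Nat.sInf_mem ⟨d + 1, d.succ_pos, fun k hk =>
      (hnu k).2 (latticeWeights_succ_subset hL (by simpa using hk))⟩
  have hnu_mem_d : 0 < nuInv (Set.range v) (convexHull ℝ (Set.range v)) ∧
      ∀ k : ℕ, nuInv (Set.range v) (convexHull ℝ (Set.range v)) ≤ k →
        latticePts (((k : ℝ) + 1) • convexHull ℝ (Set.range v)) =
          latticePts (convexHull ℝ (Set.range v)) +
            latticePts ((k : ℝ) • convexHull ℝ (Set.range v)) :=
    ⟨hnu_mem.1, fun k hk =>
      (hd k).2 (((hnu k).1 (hnu_mem.2 k hk)).trans (Set.add_subset_add_right hE))⟩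
  have hd_mem : dInv (convexHull ℝ (Set.range v)) ∈ _ := Nat.sInf_mem ⟨_, hnu_mem_d⟩
  have hle : dInv (convexHull ℝ (Set.range v)) ≤
      nuInv (Set.range v) (convexHull ℝ (Set.range v)) := Nat.sInf_le hnu_mem_d
  obtain ⟨hd_pos, hd_mem⟩ := hd_mem
  obtain ⟨hnu_pos, hnu_mem⟩ := hnu_mem
  obtain ⟨e, he⟩ := Nat.exists_eq_add_of_lt hd_pos
  rw [zero_add] at he
  rw [he] at hle hd_mem ⊢
  refine Nat.sInf_le ⟨by omega, fun k hk => isKNormal_of_latticeWeights_subset ?_⟩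
  exact latticeWeights_subset_nsmul hL
    (fun i k z hz => exists_add_nsmul_single_mem hlat hind hva i k hz) hle (by omega)
    (fun m hm => (hd m).1 (hd_mem m hm)) (fun m hm => (hnu m).1 (hnu_mem m hm))
end

section
/- Let P = conv(v_0, …, v_d) ⊂ ℝ^d be a lattice d-simplex that is not unimodularly equivalent to the standard simplex Δ_d = conv(0, e_1, …, e_d), i.e., P is not the image of Δ_d under an affine transformation of ℝ^d mapping ℤ^d bijectively onto ℤ^d. Then deg(P) ≥ ν_P. -/
open Set MeasureTheory
open scoped Pointwise

/-- The standard `n`-simplex `Δ_n = conv(0, e_1, …, e_n) ⊆ ℝ^n`. -/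
def stdSimplexSet (n : ℕ) : Set (Fin n → ℝ) :=
  convexHull ℝ (insert 0 (Set.range fun i : Fin n => Pi.single i (1 : ℝ)))

/-- `P` is unimodularly equivalent to the standard simplex: `P` is the image of `Δ_n`
under an affine transformation of `ℝ^n` mapping `ℤ^n` bijectively onto `ℤ^n`. -/
def UnimodEquivToStd {n : ℕ} (P : Set (Fin n → ℝ)) : Prop :=
  ∃ (A : Matrix (Fin n) (Fin n) ℤ) (b : Fin n → ℤ), IsUnit A.det ∧
    P = (fun x => (A.map (Int.cast : ℤ → ℝ)).mulVec x + fun i => (b i : ℝ)) ''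
      stdSimplexSet n

theorem IsLatticePt.sum_intCast_smul {n : ℕ} {ι : Type*} [Fintype ι] {v : ι → Fin n → ℝ}
    (hv : ∀ i, IsLatticePt (v i)) (c : ι → ℤ) : IsLatticePt (∑ i, (c i : ℝ) • v i) := fun j => by
  choose z hz using fun i => hv i j
  exact ⟨∑ i, c i * z i, by simp [Finset.sum_apply, hz]⟩

theorem isLatticePt_single {n : ℕ} (j : Fin n) : IsLatticePt (Pi.single j (1 : ℝ)) := fun i =>
  ⟨if i = j then 1 else 0, by by_cases h : i = j <;> simp [h]⟩

/-- No lattice points lie in the interior of the dilates `kP` with `1 ≤ k ≤ n - deg P`. -/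
theorem latticePts_interior_smul_eq_empty {n : ℕ} {P : Set (Fin n → ℝ)} {k : ℕ} (hk : 1 ≤ k)
    (hkd : k + polyDeg P ≤ n) : latticePts (interior ((k : ℝ) • P)) = ∅ := by
  unfold polyDeg at hkd
  split_ifs at hkd with h
  · omega
  · have hne : {i | ∀ k : ℕ, 1 ≤ k → k ≤ n - i →
        latticePts (interior ((k : ℝ) • P)) = ∅}.Nonempty :=
      ⟨n, fun k h1 h2 => by omega⟩
    exact Nat.sInf_mem hne k hk (by omega)

namespace AffineBasis

variable {ι E : Type*} [Fintype ι] [NormedAddCommGroup E] [NormedSpace ℝ E]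

theorem coord_sum_smul (b : AffineBasis ι ℝ E) {w : ι → ℝ} (hw : ∑ i, w i = 1) (i : ι) :
    b.coord i (∑ j, w j • b j) = w i := by
  rw [← Finset.affineCombination_eq_linear_combination _ _ _ hw]
  exact b.coord_apply_combination_of_mem (Finset.mem_univ i) hw

theorem sum_smul_mem_smul_convexHull (b : AffineBasis ι ℝ E) {w : ι → ℝ} {c : ℝ} (hc : 0 < c)
    (hw : ∑ i, w i = c) (hnonneg : ∀ i, 0 ≤ w i) :
    ∑ i, w i • b i ∈ c • convexHull ℝ (range b) := by
  rw [mem_smul_set_iff_inv_smul_mem₀ hc.ne', b.convexHull_eq_nonneg_coord]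
  intro i
  simp only [Finset.smul_sum, smul_smul]
  rw [b.coord_sum_smul (by rw [← Finset.mul_sum, hw, inv_mul_cancel₀ hc.ne'])]
  exact mul_nonneg (inv_nonneg.2 hc.le) (hnonneg i)

theorem sum_smul_mem_interior_smul_convexHull (b : AffineBasis ι ℝ E) {w : ι → ℝ} {c : ℝ}
    (hc : 0 < c) (hw : ∑ i, w i = c) (hpos : ∀ i, 0 < w i) :
    ∑ i, w i • b i ∈ interior (c • convexHull ℝ (range b)) := by
  rw [interior_smul₀ hc.ne', mem_smul_set_iff_inv_smul_mem₀ hc.ne', b.interior_convexHull]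
  intro i
  simp only [Finset.smul_sum, smul_smul]
  rw [b.coord_sum_smul (by rw [← Finset.mul_sum, hw, inv_mul_cancel₀ hc.ne'])]
  exact mul_pos (inv_pos.2 hc) (hpos i)

theorem exists_eq_sum_smul_of_mem_smul_convexHull (b : AffineBasis ι ℝ E) {c : ℝ} (hc : 0 ≤ c)
    {x : E} (hx : x ∈ c • convexHull ℝ (range b)) :
    ∃ w : ι → ℝ, (∀ i, 0 ≤ w i) ∧ ∑ i, w i = c ∧ x = ∑ i, w i • b i := by
  obtain ⟨p, hp, rfl⟩ := hx
  rw [b.convexHull_eq_nonneg_coord] at hp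
  refine ⟨fun i => c * b.coord i p, fun i => mul_nonneg hc (hp i), ?_, ?_⟩
  · rw [← Finset.mul_sum, b.sum_coord_apply_eq_one, mul_one]
  · simp only [mul_smul]
    rw [← Finset.smul_sum, b.linear_combination_coord_eq_self]

end AffineBasis

/-- If all barycentric coefficients of a lattice point of `(k+1)P` are less than `1`, then
`k < deg P`. -/
theorem lt_polyDeg_of_coeff_lt_one {d : ℕ} (b : AffineBasis (Fin (d + 1)) ℝ (Fin d → ℝ))
    (hb : ∀ i, IsLatticePt (b i)) {w : Fin (d + 1) → ℝ} {k : ℕ} (hw : ∑ i, w i = (k : ℝ) + 1)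
    (hlt : ∀ i, w i < 1) (hx : IsLatticePt (∑ i, w i • b i)) :
    k < polyDeg (convexHull ℝ (range b)) := by
  by_contra! hk
  have hsum : ∑ i, (1 - w i) = (d : ℝ) - k := by
    rw [Finset.sum_sub_distrib, hw]
    simp
  have hkd : k < d := by
    have : 0 < ∑ i, (1 - w i) := Finset.sum_pos (fun i _ => by linarith [hlt i]) ⟨0, by simp⟩
    rw [hsum] at this
    exact_mod_cast sub_pos.1 this
  have hcast : ((d - k : ℕ) : ℝ) = d - k := Nat.cast_sub hkd.le
  have hmem := b.sum_smul_mem_interior_smul_convexHull (w := fun i => 1 - w i)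
    (c := ((d - k : ℕ) : ℝ)) (by exact_mod_cast Nat.sub_pos_of_lt hkd) (by rw [hsum, hcast])
    (fun i => sub_pos.2 (hlt i))
  have hlat : IsLatticePt (∑ i, (1 - w i) • b i) := by
    simp only [sub_smul, Finset.sum_sub_distrib]
    refine IsLatticePt.sub ?_ hx
    simpa using IsLatticePt.sum_intCast_smul hb (fun _ => 1)
  have hempty := latticePts_interior_smul_eq_empty (P := convexHull ℝ (range b)) (k := d - k)
    (by omega) (by omega)
  exact Set.eq_empty_iff_forall_notMem.1 hempty _ ⟨hmem, hlat⟩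

/-- If `P` has degree `0`, lattice points have integral barycentric coordinates. -/
theorem coord_eq_intCast_of_polyDeg_eq_zero {d : ℕ}
    (b : AffineBasis (Fin (d + 1)) ℝ (Fin d → ℝ)) (hb : ∀ i, IsLatticePt (b i))
    (hdeg : polyDeg (convexHull ℝ (range b)) = 0) {x : Fin d → ℝ} (hx : IsLatticePt x)
    (i : Fin (d + 1)) : b.coord i x = (⌊b.coord i x⌋ : ℝ) := by
  by_contra hi
  set w : Fin (d + 1) → ℝ := fun i => Int.fract (b.coord i x) with hwdef
  have hsum : ∑ i, w i = ((1 - ∑ i, ⌊b.coord i x⌋ : ℤ) : ℝ) := by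
    simp only [hwdef, Int.fract, Finset.sum_sub_distrib, b.sum_coord_apply_eq_one]
    push_cast
    rfl
  have hpos : 0 < ∑ i, w i := by
    refine Finset.sum_pos' (fun i _ => Int.fract_nonneg _) ⟨i, Finset.mem_univ i, ?_⟩
    exact lt_of_le_of_ne (Int.fract_nonneg _) fun h => hi (sub_eq_zero.1 h.symm)
  have hlat : IsLatticePt (∑ i, w i • b i) := by
    simp only [hwdef, Int.fract, sub_smul, Finset.sum_sub_distrib,
      b.linear_combination_coord_eq_self]
    exact hx.sub (IsLatticePt.sum_intCast_smul hb _)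
  obtain ⟨m, hm⟩ : ∃ m : ℕ, 1 - ∑ i, ⌊b.coord i x⌋ = (m : ℤ) + 1 := by
    rw [hsum] at hpos
    have : 0 < 1 - ∑ i, ⌊b.coord i x⌋ := by exact_mod_cast hpos
    exact ⟨(-∑ i, ⌊b.coord i x⌋).toNat, by omega⟩
  rw [hm] at hsum
  have := lt_polyDeg_of_coeff_lt_one b hb (k := m) (by rw [hsum]; push_cast; rfl)
    (fun i => Int.fract_lt_one _) hlat
  omega

/-- A lattice simplex of degree `0` is unimodularly equivalent to the standard simplex. -/
theorem unimodEquivToStd_of_polyDeg_eq_zero {d : ℕ}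
    (b : AffineBasis (Fin (d + 1)) ℝ (Fin d → ℝ)) (hb : ∀ i, IsLatticePt (b i))
    (hdeg : polyDeg (convexHull ℝ (range b)) = 0) :
    UnimodEquivToStd (convexHull ℝ (range b)) := by
  choose z hz using hb
  set A : Matrix (Fin d) (Fin d) ℤ := Matrix.of fun i j => z j.succ i - z 0 i with hA
  set f : (Fin d → ℝ) →ᵃ[ℝ] (Fin d → ℝ) :=
    (Matrix.mulVecLin (A.map (Int.cast : ℤ → ℝ))).toAffineMap +
      AffineMap.const ℝ _ (fun i => (z 0 i : ℝ)) with hf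
  refine ⟨A, z 0, ?_, ?_⟩
  · set B : Matrix (Fin d) (Fin d) ℤ :=
      Matrix.of fun i j => ⌊b.coord i.succ (b 0 + Pi.single j 1)⌋ with hB
    have hAB : A * B = 1 := by
      ext i j
      have hlat : IsLatticePt (b 0 + Pi.single j 1) :=
        IsLatticePt.add (fun i => ⟨_, hz 0 i⟩) (isLatticePt_single j)
      have hcoord := coord_eq_intCast_of_polyDeg_eq_zero b (fun i j => ⟨_, hz i j⟩) hdeg hlat
      have h1 := b.sum_coord_apply_eq_one (b 0 + Pi.single j 1)
      have h2 := congrFun (b.linear_combination_coord_eq_self (b 0 + Pi.single j 1)) i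
      rw [Fin.sum_univ_succ] at h1
      simp only [Finset.sum_apply, Pi.smul_apply, smul_eq_mul, Pi.add_apply] at h2
      rw [Fin.sum_univ_succ] at h2
      have h3 : ((A * B) i j : ℝ) = (Pi.single j (1 : ℝ) : Fin d → ℝ) i := by
        rw [Matrix.mul_apply]
        push_cast
        have : ∀ l, (A i l : ℝ) * (B l j : ℝ) =
            b.coord l.succ (b 0 + Pi.single j 1) * b l.succ i -
              b.coord l.succ (b 0 + Pi.single j 1) * b 0 i := fun l => by
          rw [hB, Matrix.of_apply, ← hcoord, hA, Matrix.of_apply, hz, hz]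
          push_cast
          ring
        simp only [this, Finset.sum_sub_distrib, ← Finset.sum_mul]
        linear_combination h2 - b 0 i * h1
      have h4 : ((1 : Matrix (Fin d) (Fin d) ℤ) i j : ℝ) = (Pi.single j (1 : ℝ) : Fin d → ℝ) i := by
        by_cases h : i = j <;> simp [Matrix.one_apply, h]
      exact_mod_cast h3.trans h4.symm
    exact (Matrix.isUnit_iff_isUnit_det A).1 (IsUnit.of_mul_eq_one B hAB)
  · change _ = f '' _
    have hf0 : f 0 = b 0 := by
      ext i
      simp [hf, hz]
    have hfs : ∀ j, f (Pi.single j 1) = b (Fin.succ j) := fun j => by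
      ext i
      simp [hf, hA, hz]
    rw [stdSimplexSet, AffineMap.image_convexHull, image_insert_eq, ← range_comp, hf0,
      Fin.range_fin_succ b]
    congr 3
    exact funext fun j => (hfs j).symm

/-- `deg(P) ≥ ν_P` for lattice simplices not unimodularly equivalent to
the standard simplex. -/
theorem stmt3 {d : ℕ} (v : Fin (d + 1) → Fin d → ℝ)
    (hlat : ∀ i, IsLatticePt (v i)) (hind : AffineIndependent ℝ v)
    (hne : ¬ UnimodEquivToStd (convexHull ℝ (Set.range v))) :
    nuInv (Set.range v) (convexHull ℝ (Set.range v)) ≤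
      polyDeg (convexHull ℝ (Set.range v)) := by
  obtain ⟨b, rfl⟩ : ∃ b : AffineBasis (Fin (d + 1)) ℝ (Fin d → ℝ), ⇑b = v :=
    ⟨⟨v, hind, hind.affineSpan_eq_top_iff_card_eq_finrank_add_one.2 (by simp)⟩, rfl⟩
  have hpos : 0 < polyDeg (convexHull ℝ (range b)) :=
    Nat.pos_of_ne_zero fun h => hne (unimodEquivToStd_of_polyDeg_eq_zero b hlat h)
  refine Nat.sInf_le ⟨hpos, fun k hk => Subset.antisymm ?_ ?_⟩
  · rintro x ⟨hx, hxlat⟩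
    obtain ⟨w, hw0, hw, rfl⟩ := b.exists_eq_sum_smul_of_mem_smul_convexHull (by positivity) hx
    obtain ⟨i, hi⟩ : ∃ i, 1 ≤ w i := by
      by_contra! h
      exact absurd (lt_polyDeg_of_coeff_lt_one b hlat hw h hxlat) (by omega)
    have heq : ∑ j, (w j - (Pi.single i 1 : Fin (d + 1) → ℝ) j) • b j = ∑ j, w j • b j - b i := by
      simp [sub_smul, Finset.sum_sub_distrib, Pi.single_apply]
    refine ⟨b i, ⟨i, rfl⟩, ∑ j, w j • b j - b i, ⟨?_, hxlat.sub (hlat i)⟩, by simp⟩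
    rw [← heq]
    refine b.sum_smul_mem_smul_convexHull (by exact_mod_cast hpos.trans_le hk) ?_ fun j => ?_
    · simp [Finset.sum_sub_distrib, hw]
    · by_cases h : j = i
      · subst h
        simpa using hi
      · simpa [h] using hw0 j
  · rintro _ ⟨_, ⟨i, rfl⟩, y, ⟨hy, hylat⟩, rfl⟩
    refine ⟨?_, (hlat i).add hylat⟩
    rw [add_comm (k : ℝ) 1,
      (convex_convexHull ℝ (range b)).add_smul zero_le_one (Nat.cast_nonneg k), one_smul]
    exact add_mem_add (subset_convexHull ℝ _ ⟨i, rfl⟩) hy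
end

section
/- Let P = conv(v_0, …, v_d) ⊂ ℝ^d be a very ample lattice d-simplex with d ≥ 2. Then max{k_P, deg(P)} ≤ Vol(P) − |P ∩ M| + d + ⌊d/2⌋. (This is the combinatorial form of the theorem that a fake weighted projective space X embedded by a very ample line bundle satisfies reg(X) ≤ deg(X) − codim(X) + ⌊dim(X)/2⌋, via reg(X) = max{k_P, deg(P)} + 1, deg(X) = Vol(P) and codim(X) = |P ∩ M| − d − 1.) -/
open Set MeasureTheory
open scoped Pointwise

/-- The points of a group of barycentric coordinate vectors whose coordinates all lie in
`[0, 1)`. -/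
def unitBox {ι : Type*} (L : AddSubgroup (ι → ℝ)) : Set (ι → ℝ) :=
  {w | w ∈ L ∧ ∀ i, 0 ≤ w i ∧ w i < 1}

/-- The points of a group of barycentric coordinate vectors lying in the standard simplex. -/
def heightOne {ι : Type*} [Fintype ι] (L : AddSubgroup (ι → ℝ)) : Set (ι → ℝ) :=
  {u | u ∈ L ∧ (∀ i, 0 ≤ u i) ∧ ∑ i, u i = 1}

/-- The points of `unitBox L` of height at least two. -/
def highBox {ι : Type*} [Fintype ι] (L : AddSubgroup (ι → ℝ)) : Set (ι → ℝ) :=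
  {w | w ∈ unitBox L ∧ 2 ≤ ∑ i, w i}

/-- The properties of the group of barycentric coordinates of the lattice points in the cone over
a very ample lattice simplex. -/
structure IsVeryAmpleGroup {ι : Type*} [Fintype ι] [DecidableEq ι] (L : AddSubgroup (ι → ℝ)) :
    Prop where
  single_mem : ∀ i, Pi.single i 1 ∈ L
  sum_int : ∀ x ∈ L, ∃ z : ℤ, ∑ i, x i = z
  finite_unitBox : (unitBox L).Finite
  exists_le : ∀ i, ∀ x ∈ L, (∀ l ≠ i, 0 ≤ x l) → (∃ l ≠ i, x l ≠ 0) →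
    ∃ u ∈ heightOne L, u i < 1 ∧ ∀ l ≠ i, u l ≤ x l

namespace IsVeryAmpleGroup

variable {ι : Type*} [Fintype ι] [DecidableEq ι] {L : AddSubgroup (ι → ℝ)}

theorem single_mem_heightOne (hL : IsVeryAmpleGroup L) (i : ι) :
    Pi.single i 1 ∈ heightOne L := by
  refine ⟨hL.single_mem i, fun j => ?_, by simp⟩
  rw [Pi.single_apply]; split_ifs <;> norm_num

theorem intCast_mem (hL : IsVeryAmpleGroup L) (c : ι → ℤ) : (fun i => (c i : ℝ)) ∈ L := by
  have : (fun i => (c i : ℝ)) = ∑ i, c i • (Pi.single i (1 : ℝ) : ι → ℝ) := by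
    ext j
    simp [Finset.sum_apply, Pi.single_apply]
  rw [this]
  exact sum_mem fun i _ => L.zsmul_mem (hL.single_mem i) _

theorem fract_mem (hL : IsVeryAmpleGroup L) {x : ι → ℝ} (hx : x ∈ L) :
    (fun i => Int.fract (x i)) ∈ unitBox L := by
  refine ⟨?_, fun i => ⟨Int.fract_nonneg _, Int.fract_lt_one _⟩⟩
  exact L.sub_mem hx (hL.intCast_mem fun i => ⌊x i⌋)

theorem exists_height (hL : IsVeryAmpleGroup L) {x : ι → ℝ} (hx : x ∈ L) (h0 : ∀ i, 0 ≤ x i) :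
    ∃ h : ℕ, ∑ i, x i = h := by
  obtain ⟨z, hz⟩ := hL.sum_int x hx
  have : (0 : ℝ) ≤ z := hz ▸ Finset.sum_nonneg fun i _ => h0 i
  lift z to ℕ using by exact_mod_cast this
  exact ⟨z, by simpa using hz⟩

theorem finite_highBox (hL : IsVeryAmpleGroup L) : (highBox L).Finite :=
  hL.finite_unitBox.subset fun _ h => h.1

theorem exists_ne_of_height {w : ι → ℝ} (hw : w ∈ unitBox L) (h1 : 1 ≤ ∑ i, w i) (i : ι) :
    ∃ l ≠ i, w l ≠ 0 := by
  by_contra! h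
  rw [Fintype.sum_eq_single i h] at h1
  linarith [(hw.2 i).2]

/-- Subtracting a lattice point of the simplex from a box point, up to adding the vertex `i`. -/
theorem exists_step (hL : IsVeryAmpleGroup L) {w : ι → ℝ} (hw : w ∈ unitBox L)
    (h1 : 1 ≤ ∑ i, w i) (i : ι) :
    ∃ u ∈ heightOne L, u i < 1 ∧ (∀ l ≠ i, u l ≤ w l) ∧
      (w - u ∈ unitBox L ∨ w - u + Pi.single i 1 ∈ unitBox L) := by
  obtain ⟨u, hu, hui, hul⟩ := hL.exists_le i w hw.1 (fun l _ => (hw.2 l).1)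
    (exists_ne_of_height hw h1 i)
  refine ⟨u, hu, hui, hul, ?_⟩
  have hl : ∀ l ≠ i, 0 ≤ w l - u l ∧ w l - u l < 1 := fun l hl =>
    ⟨by linarith [hul l hl], by linarith [(hw.2 l).2, hu.2.1 l]⟩
  have hwi := hw.2 i
  have hui0 := hu.2.1 i
  by_cases h : u i ≤ w i
  · refine Or.inl ⟨L.sub_mem hw.1 hu.1, fun l => ?_⟩
    obtain rfl | hne := eq_or_ne l i
    · exact ⟨by simp only [Pi.sub_apply]; linarith, by simp only [Pi.sub_apply]; linarith⟩
    · exact hl l hne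
  · refine Or.inr ⟨L.add_mem (L.sub_mem hw.1 hu.1) (hL.single_mem i), fun l => ?_⟩
    obtain rfl | hne := eq_or_ne l i
    · simp only [Pi.add_apply, Pi.sub_apply, Pi.single_eq_same]
      exact ⟨by linarith, by linarith⟩
    · simpa [hne] using hl l hne

theorem sum_compl_lt {i : ι} {w u : ι → ℝ} (hu : u ∈ heightOne L) (hui : u i < 1) {y : ι → ℝ}
    (hy : ∀ l ≠ i, y l = w l - u l) :
    ∑ l ∈ Finset.univ.erase i, y l < ∑ l ∈ Finset.univ.erase i, w l := by
  have h1 := Finset.add_sum_erase Finset.univ u (Finset.mem_univ i)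
  rw [hu.2.2] at h1
  rw [Finset.sum_congr rfl fun l hl => hy l (Finset.ne_of_mem_erase hl), Finset.sum_sub_distrib]
  linarith

theorem exists_height_pred [Nonempty ι] (hL : IsVeryAmpleGroup L) {h : ℕ} {w : ι → ℝ}
    (hw : w ∈ unitBox L) (hwh : ∑ i, w i = (h + 1 : ℕ)) :
    ∃ w' ∈ unitBox L, ∑ i, w' i = h := by
  obtain ⟨i⟩ := ‹Nonempty ι›
  obtain ⟨y, ⟨hy, hyh⟩, hmin⟩ := Set.exists_min_image
    {w | w ∈ unitBox L ∧ ∑ i, w i = (h + 1 : ℕ)} (fun w => ∑ l ∈ Finset.univ.erase i, w l)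
    (hL.finite_unitBox.subset fun _ h => h.1) ⟨w, hw, hwh⟩
  have h1 : 1 ≤ ∑ i, y i := by rw [hyh]; push_cast; linarith [h.cast_nonneg (α := ℝ)]
  obtain ⟨u, hu, hui, -, hbox⟩ := hL.exists_step hy h1 i
  rcases hbox with hbox | hbox
  · refine ⟨_, hbox, ?_⟩
    simp only [Pi.sub_apply, Finset.sum_sub_distrib, hyh, hu.2.2]
    push_cast; ring
  · have := hmin _ ⟨hbox, by
      simp only [Pi.sub_apply, Pi.add_apply, Finset.sum_add_distrib, Finset.sum_sub_distrib, hyh,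
        hu.2.2, Finset.sum_pi_single']
      simp⟩
    exact absurd (sum_compl_lt hu hui (y := y - u + Pi.single i 1) (w := y)
      (fun l hl => by simp [hl])) (not_lt.2 this)

theorem height_le [Nonempty ι] (hL : IsVeryAmpleGroup L) {h : ℕ} {w : ι → ℝ}
    (hw : w ∈ unitBox L) (hwh : ∑ i, w i = h) : h ≤ (highBox L).ncard + 1 := by
  have key : ∀ j ≤ h, ∃ w' ∈ unitBox L, ∑ i, w' i = (h - j : ℕ) := by
    intro j
    induction j with
    | zero => exact fun _ => ⟨w, hw, hwh⟩
    | succ j ih =>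
      intro hj
      obtain ⟨w', hw', hs⟩ := ih (by omega)
      exact hL.exists_height_pred hw' (h := h - (j + 1)) (by rw [hs]; congr 1; omega)
  have key' : ∀ j : ℕ, ∃ w', j < h - 1 → w' ∈ highBox L ∧ ∑ i, w' i = (j + 2 : ℕ) := by
    intro j
    by_cases hj : j < h - 1
    · obtain ⟨w', hw', hs⟩ := key (h - (j + 2)) (by omega)
      have hs' : ∑ i, w' i = (j + 2 : ℕ) := by rw [hs]; congr 1; omega
      refine ⟨w', fun _ => ⟨⟨hw', ?_⟩, hs'⟩⟩
      rw [hs']; push_cast; linarith [j.cast_nonneg (α := ℝ)]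
    · exact ⟨0, fun h => absurd h hj⟩
  choose f hf using key'
  have := Set.ncard_le_ncard_of_injOn (s := (Finset.range (h - 1) : Set ℕ)) (t := highBox L) f
    (fun j hj => (hf j (by simpa using hj)).1)
    (fun j hj j' hj' he => by
      have h1 := (hf j (by simpa using hj)).2
      have h2 := (hf j' (by simpa using hj')).2
      rw [he, h2] at h1
      have : j' + 2 = j + 2 := by exact_mod_cast h1
      omega) hL.finite_highBox
  rw [Set.ncard_coe_finset, Finset.card_range] at this
  omega

theorem exists_le_of_card_le (hL : IsVeryAmpleGroup L) {h : ℕ} {w : ι → ℝ}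
    (hw : w ∈ unitBox L) (hwh : ∑ i, w i = h) (h2 : 2 ≤ h) (hcard : Fintype.card ι ≤ 2 * h) :
    ∃ u ∈ heightOne L, ∀ l, u l ≤ w l := by
  have h2' : (2 : ℝ) ≤ ∑ i, w i := by rw [hwh]; exact_mod_cast h2
  obtain ⟨i, hi⟩ : ∃ i, 1 / 2 ≤ w i := by
    by_contra! hlt
    have hne : (Finset.univ : Finset ι).Nonempty := by
      by_contra hne
      rw [Finset.not_nonempty_iff_eq_empty] at hne
      rw [hne, Finset.sum_empty] at h2'
      linarith
    have := Finset.sum_lt_sum_of_nonempty hne fun i _ => hlt i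
    rw [hwh, Finset.sum_const, Finset.card_univ, nsmul_eq_mul] at this
    have hc : (Fintype.card ι : ℝ) ≤ 2 * h := by exact_mod_cast hcard
    linarith
  by_contra! hcon
  have hbig : ∀ u ∈ heightOne L, (∀ l ≠ i, u l ≤ w l) → w i < u i := by
    intro u hu hul
    obtain ⟨l, hl⟩ := hcon u hu
    by_cases hli : l = i
    · exact hli ▸ hl
    · exact absurd (hul l hli) (not_le.2 hl)
  set A : Set (ι → ℝ) := {u | u ∈ heightOne L ∧ u i < 1 ∧ ∀ l ≠ i, u l ≤ w l} with hA
  have hAfin : A.Finite := hL.finite_unitBox.subset fun u ⟨hu, hui, hul⟩ =>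
    ⟨hu.1, fun l => ⟨hu.2.1 l, by
      by_cases hli : l = i
      · exact hli ▸ hui
      · exact (hul l hli).trans_lt (hw.2 l).2⟩⟩
  have hAne : A.Nonempty := by
    obtain ⟨u, hu, hui, hul, -⟩ := hL.exists_step hw (by linarith) i
    exact ⟨u, hu, hui, hul⟩
  obtain ⟨u, ⟨hu, hui, hul⟩, hmin⟩ := Set.exists_min_image A (fun u => u i) hAfin hAne
  have hwu := hbig u hu hul
  have hrest : ∃ l ≠ i, (w - u) l ≠ 0 := by
    by_contra! hz
    have h1 : ∑ l, (w - u) l = (w - u) i := Fintype.sum_eq_single i hz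
    simp only [Pi.sub_apply, Finset.sum_sub_distrib, hu.2.2] at h1
    linarith
  obtain ⟨u', hu', hui', hul'⟩ := hL.exists_le i (w - u) (L.sub_mem hw.1 hu.1)
    (fun l hl => by simpa using hul l hl) hrest
  have hle' : ∀ l ≠ i, u' l ≤ w l := fun l hl =>
    (hul' l hl).trans (by simpa using hu.2.1 l)
  have hwu' := hbig u' hu' hle'
  have hmem : u + u' - Pi.single i 1 ∈ A := by
    refine ⟨⟨L.sub_mem (L.add_mem hu.1 hu'.1) (hL.single_mem i), fun l => ?_, ?_⟩, ?_, ?_⟩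
    · by_cases hli : l = i
      · subst hli; simp; linarith
      · simp only [Pi.sub_apply, Pi.add_apply, Pi.single_eq_of_ne hli]
        linarith [hu.2.1 l, hu'.2.1 l]
    · simp [Finset.sum_add_distrib, hu.2.2, hu'.2.2]
    · simp; linarith
    · intro l hl
      have := hul' l hl
      simp only [Pi.sub_apply, Pi.add_apply, Pi.single_eq_of_ne hl] at this ⊢
      linarith
  have := hmin _ hmem
  simp at this
  linarith

end IsVeryAmpleGroup

/-- `x` is the sum of the box point `w`, the simplex points in `s`, and `c i` copies of each
vertex `i`. -/
structure IsRep {ι : Type*} [Fintype ι] (L : AddSubgroup (ι → ℝ)) (x w : ι → ℝ)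
    (s : List (ι → ℝ)) (c : ι → ℕ) : Prop where
  mem_unitBox : w ∈ unitBox L
  mem_heightOne : ∀ u ∈ s, u ∈ heightOne L
  eq_sum : x = w + s.sum + fun i => (c i : ℝ)

namespace IsRep

variable {ι : Type*} [Fintype ι] {L : AddSubgroup (ι → ℝ)}
  {x w : ι → ℝ} {s s₁ s₂ : List (ι → ℝ)} {c : ι → ℕ}

theorem perm (h : IsRep L x w s₁ c) (hs : s₁.Perm s₂) : IsRep L x w s₂ c :=
  ⟨h.mem_unitBox, fun u hu => h.mem_heightOne u (hs.mem_iff.2 hu), hs.sum_eq ▸ h.eq_sum⟩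

theorem sum_mem_group (hs : ∀ u ∈ s, u ∈ heightOne L) : s.sum ∈ L :=
  L.list_sum_mem fun u hu => (hs u hu).1

theorem sum_apply_nonneg (hs : ∀ u ∈ s, u ∈ heightOne L) (i : ι) : 0 ≤ s.sum i := by
  induction s with
  | nil => simp
  | cons a s ih =>
    rw [List.sum_cons, Pi.add_apply]
    exact add_nonneg ((hs a (by simp)).2.1 i) (ih fun u hu => hs u (by simp [hu]))

theorem sum_sum_eq_length (hs : ∀ u ∈ s, u ∈ heightOne L) : ∑ i, s.sum i = s.length := by
  induction s with
  | nil => simp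
  | cons a s ih =>
    simp only [List.sum_cons, Pi.add_apply, Finset.sum_add_distrib, List.length_cons,
      (hs a (by simp)).2.2, ih fun u hu => hs u (by simp [hu])]
    push_cast; ring

variable [DecidableEq ι]

/-- Absorb part of the list into the box point. -/
theorem absorb (hL : IsVeryAmpleGroup L) (h : IsRep L x w (s₁ ++ s₂) c) :
    ∃ c', IsRep L x (fun i => Int.fract ((w + s₁.sum) i)) s₂ c' := by
  have h1 : ∀ u ∈ s₁, u ∈ heightOne L := fun u hu => h.mem_heightOne u (by simp [hu])
  refine ⟨fun i => c i + ⌊(w + s₁.sum) i⌋₊,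
    hL.fract_mem (L.add_mem h.mem_unitBox.1 (sum_mem_group h1)),
    fun u hu => h.mem_heightOne u (by simp [hu]), ?_⟩
  ext i
  have hnn : 0 ≤ (w + s₁.sum) i := add_nonneg (h.mem_unitBox.2 i).1 (sum_apply_nonneg h1 i)
  have hfl : ((⌊(w + s₁.sum) i⌋₊ : ℕ) : ℝ) = (⌊(w + s₁.sum) i⌋ : ℝ) := by
    exact_mod_cast congrArg (Int.cast : ℤ → ℝ) (Int.natCast_floor_eq_floor hnn)
  have := Int.fract_add_floor ((w + s₁.sum) i)
  rw [h.eq_sum, List.sum_append]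
  simp only [Pi.add_apply, Nat.cast_add] at hfl this ⊢
  rw [hfl]
  linarith

theorem two_le (hL : IsVeryAmpleGroup L) (hx : x ∉ AddSubmonoid.closure (heightOne L))
    (h : IsRep L x w s c) : 2 ≤ ∑ i, w i := by
  by_contra! hlt
  obtain ⟨n, hn⟩ := hL.exists_height h.mem_unitBox.1 fun i => (h.mem_unitBox.2 i).1
  have hn2 : n < 2 := by rw [hn] at hlt; exact_mod_cast hlt
  refine hx (h.eq_sum ▸ add_mem (add_mem ?_ ?_) ?_)
  · interval_cases n
    · have : w = 0 := by
        ext i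
        exact (Finset.sum_eq_zero_iff_of_nonneg fun i _ => (h.mem_unitBox.2 i).1).1
          (by simpa using hn) i (Finset.mem_univ i)
      exact this ▸ zero_mem _
    · exact AddSubmonoid.subset_closure
        ⟨h.mem_unitBox.1, fun i => (h.mem_unitBox.2 i).1, by simpa using hn⟩
  · exact list_sum_mem fun u hu => AddSubmonoid.subset_closure (h.mem_heightOne u hu)
  · have : (fun i => (c i : ℝ)) = ∑ i, c i • (Pi.single i (1 : ℝ) : ι → ℝ) := by
      ext j
      simp [Finset.sum_apply, Pi.single_apply]
    rw [this]
    exact sum_mem fun i _ =>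
      nsmul_mem (AddSubmonoid.subset_closure (hL.single_mem_heightOne i)) _

/-- Starting from a representation of an indecomposable point whose box point has minimal height
and whose list is as short as possible, the partial sums and the partial exchanges with the
vertices give pairwise different box points of height at least two. -/
theorem length_add_sum_lt (hL : IsVeryAmpleGroup L)
    (hx : x ∉ AddSubmonoid.closure (heightOne L)) (h : IsRep L x w s c)
    (hmin : ∀ w' s' c', IsRep L x w' s' c' → ∑ i, w i ≤ ∑ i, w' i)
    (hlen : ∀ w' s' c', IsRep L x w' s' c' → ∑ i, w' i = ∑ i, w i → s.length ≤ s'.length) :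
    s.length + ∑ i, c i < (highBox L).ncard := by
  have hstep : ∀ (i : ι) (y : ι → ℝ), ∃ u, y ∈ unitBox L → 1 ≤ ∑ i, y i →
      u ∈ heightOne L ∧ u i < 1 ∧ (∀ l ≠ i, u l ≤ y l) ∧
      (y - u ∈ unitBox L ∨ y - u + Pi.single i 1 ∈ unitBox L) := by
    intro i y
    by_cases hy : y ∈ unitBox L ∧ 1 ≤ ∑ i, y i
    · obtain ⟨u, hu⟩ := hL.exists_step hy.1 hy.2 i
      exact ⟨u, fun _ _ => hu⟩
    · exact ⟨0, fun h1 h2 => absurd ⟨h1, h2⟩ hy⟩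
  choose U hU using hstep
  set g : ι → ℕ → ι → ℝ := fun i p => (fun y => y - U i y + Pi.single i 1)^[p] w with hg
  have hchain : ∀ i, ∀ p ≤ c i, (∃ q : List (ι → ℝ), IsRep L x (g i p) (q ++ s)
      (Function.update c i (c i - p))) ∧ ∑ l, g i p l = ∑ l, w l ∧
      (∀ l ≠ i, g i p l ≤ w l) ∧ ∀ p' < p, g i p' i < g i p i := by
    intro i p
    induction p with
    | zero => exact fun _ => ⟨⟨[], by simpa [hg] using h⟩, by simp [hg], by simp [hg], by simp⟩
    | succ p ih =>
      intro hp
      obtain ⟨⟨q, hq⟩, hsum, hle, hlt⟩ := ih (by omega)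
      have h2 := hq.two_le hL hx
      obtain ⟨hu, hui, hul, hor⟩ := hU i (g i p) hq.mem_unitBox (by linarith)
      set u := U i (g i p) with hu_def
      have hgs : g i (p + 1) = g i p - u + Pi.single i 1 := by
        simp only [hg, Function.iterate_succ_apply', hu_def]
      have hmem : ∀ u' ∈ u :: (q ++ s), u' ∈ heightOne L := by
        intro u' hu'
        obtain rfl | hu' := List.mem_cons.1 hu'
        · exact hu
        · exact hq.mem_heightOne u' hu'
      rcases hor with hor | hor
      · have := hmin (g i p - u) (u :: (q ++ s)) _ ⟨hor, hmem, by
          rw [hq.eq_sum, List.sum_cons]; abel⟩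
        simp only [Pi.sub_apply, Finset.sum_sub_distrib, hsum, hu.2.2] at this
        linarith
      · rw [← hgs] at hor
        refine ⟨⟨u :: q, hor, hmem, ?_⟩, ?_, ?_, ?_⟩
        · rw [hq.eq_sum, List.cons_append, List.sum_cons, hgs]
          ext l
          by_cases hl : l = i
          · subst hl
            have : ((c l - p : ℕ) : ℝ) = ((c l - (p + 1) : ℕ) : ℝ) + 1 := by
              exact_mod_cast (show c l - p = c l - (p + 1) + 1 by omega)
            simp [this]; ring
          · simp [hl]; ring
        · rw [hgs]
          simp [Finset.sum_add_distrib, hsum, hu.2.2]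
        · intro l hl
          rw [hgs]
          have := hu.2.1 l
          have := hle l hl
          simp [hl]; linarith
        · have hlast : g i p i < g i (p + 1) i := by rw [hgs]; simp; linarith
          intro p' hp'
          obtain hp' | rfl := Nat.lt_succ_iff_lt_or_eq.1 hp'
          · exact (hlt p' hp').trans hlast
          · exact hlast
  set f : ℕ → ι → ℝ := fun t i => Int.fract ((w + (s.take t).sum) i) with hf
  have hf0 : f 0 = w := by
    ext i
    simpa [hf] using Int.fract_eq_self.2 (h.mem_unitBox.2 i)
  have hfrep : ∀ t, ∃ c', IsRep L x (f t) (s.drop t) c' := fun t =>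
    absorb hL ((List.take_append_drop t s).symm ▸ h)
  have hfinj : ∀ t p, t + p ≤ s.length → f t = f (t + p) → p = 0 := by
    intro t p htp he
    set m := (s.drop t).take p with hm
    have hsplit : s = s.take t ++ (m ++ (s.drop t).drop p) := by
      rw [hm, List.take_append_drop, List.take_append_drop]
    have hperm : s.Perm (m ++ (s.take t ++ (s.drop t).drop p)) := by
      conv_lhs => rw [hsplit]
      rw [← List.append_assoc, ← List.append_assoc]
      exact List.perm_append_comm.append_right _
    obtain ⟨c', hc'⟩ := absorb hL (h.perm hperm)
    have hw : (fun i => Int.fract ((w + m.sum) i)) = w := by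
      ext i
      have h1 := congrFun he i
      simp only [hf, List.take_add, List.sum_append] at h1
      obtain ⟨z, hz⟩ := Int.fract_eq_fract.1 h1
      rw [← hm] at hz
      simp only [Pi.add_apply] at hz ⊢
      have : m.sum i = ((-z : ℤ) : ℝ) := by push_cast; linarith
      rw [this, Int.fract_add_intCast]
      exact Int.fract_eq_self.2 (h.mem_unitBox.2 i)
    rw [hw] at hc'
    have := hlen _ _ _ hc' rfl
    simp at this
    omega
  have hfg : ∀ t ≤ s.length, ∀ i, ∀ p ≤ c i, 0 < p → f t ≠ g i p := by
    intro t ht i p hp hp0 he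
    obtain ⟨⟨q, hq⟩, hsum, -, hlt⟩ := hchain i p hp
    obtain rfl | ht0 := Nat.eq_zero_or_pos t
    · have := hlt 0 hp0
      rw [← he, hf0] at this
      simp [hg] at this
    · rw [← List.take_append_drop t s, ← List.append_assoc] at hq
      obtain ⟨c', hc'⟩ := absorb hL hq
      have hfr : (fun j => Int.fract ((g i p + (q ++ s.take t).sum) j)) = f t := by
        ext j
        have h1 := congrFun (h.eq_sum.symm.trans hq.eq_sum) j
        conv at h1 => lhs; rw [← List.take_append_drop t s]
        rw [hf]
        refine Int.fract_eq_fract.2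
          ⟨(c j : ℤ) - (Function.update c i (c i - p) j : ℤ), ?_⟩
        simp only [List.sum_append, Pi.add_apply] at h1 ⊢
        push_cast
        linarith
      rw [hfr] at hc'
      have := hlen _ _ _ hc' (by rw [he, hsum])
      simp at this
      omega
  have hgg : ∀ i j, ∀ p ≤ c i, ∀ p' ≤ c j, 0 < p → i ≠ j → g i p ≠ g j p' := by
    intro i j p hp p' hp' hp0 hij he
    have h1 := (hchain i p hp).2.2.2 0 hp0
    have h2 := (hchain j p' hp').2.2.1 i hij
    rw [← he] at h2
    simp only [hg, Function.iterate_zero, id] at h1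
    exact absurd h1 (not_lt.2 h2)
  have hgi : ∀ i, ∀ p ≤ c i, ∀ p' ≤ c i, g i p = g i p' → p = p' := by
    intro i p hp p' hp' he
    rcases lt_trichotomy p p' with hlt | heq | hlt
    · exact absurd (congrFun he i) ((hchain i p' hp').2.2.2 p hlt).ne
    · exact heq
    · exact absurd (congrFun he i) ((hchain i p hp).2.2.2 p' hlt).ne'
  let Φ : Fin (s.length + 1) ⊕ (Σ i, Fin (c i)) → highBox L := fun a => match a with
    | .inl t => ⟨f t, by
        obtain ⟨c', hc'⟩ := hfrep t
        exact ⟨hc'.mem_unitBox, hc'.two_le hL hx⟩⟩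
    | .inr ⟨i, p⟩ => ⟨g i (p + 1), by
        obtain ⟨⟨q, hq⟩, -⟩ := hchain i (p + 1) p.2
        exact ⟨hq.mem_unitBox, hq.two_le hL hx⟩⟩
  have hΦ : Function.Injective Φ := by
    rintro (t | ⟨i, p⟩) (t' | ⟨j, p'⟩) he
    · have he : f t = f t' := congrArg Subtype.val he
      congr 1
      rcases le_total (t : ℕ) t' with hle | hle
      · obtain ⟨p, hp⟩ := Nat.exists_eq_add_of_le hle
        have := hfinj t p (by omega) (by rw [he, hp])
        exact Fin.ext (by omega)
      · obtain ⟨p, hp⟩ := Nat.exists_eq_add_of_le hle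
        have := hfinj t' p (by omega) (by rw [← he, hp])
        exact Fin.ext (by omega)
    · exact absurd (congrArg Subtype.val he) (hfg t (by omega) j (p' + 1) p'.2 (by omega))
    · exact absurd (congrArg Subtype.val he).symm (hfg t' (by omega) i (p + 1) p.2 (by omega))
    · have he : g i (p + 1) = g j (p' + 1) := congrArg Subtype.val he
      obtain rfl | hij := eq_or_ne i j
      · have := hgi i _ p.2 _ p'.2 he
        have : p = p' := Fin.ext (by omega)
        rw [this]
      · exact absurd he (hgg i j _ p.2 _ p'.2 (by omega) hij)
  have := hL.finite_highBox.to_subtype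
  have hcard := Nat.card_le_card_of_injective Φ hΦ
  rw [Nat.card_coe_set_eq, Nat.card_eq_fintype_card] at hcard
  simp at hcard
  omega

end IsRep

/-- Every point of sufficiently large height is a sum of points of height one. -/
theorem IsVeryAmpleGroup.mem_closure_heightOne {ι : Type*} [Fintype ι] [DecidableEq ι]
    {L : AddSubgroup (ι → ℝ)} (hL : IsVeryAmpleGroup L) {n k : ℕ} (hn : 1 ≤ n)
    (hcard : Fintype.card ι ≤ 2 * n + 2) (hk : (highBox L).ncard + n ≤ k) {x : ι → ℝ}
    (hxL : x ∈ L) (hx0 : ∀ i, 0 ≤ x i) (hxk : ∑ i, x i = k) :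
    x ∈ AddSubmonoid.closure (heightOne L) := by
  classical
  by_contra hx
  have hex : ∃ h : ℕ, ∃ w s c, IsRep L x w s c ∧ ∑ i, w i = h := by
    refine ⟨⌊∑ i, Int.fract (x i)⌋₊, fun i => Int.fract (x i), [], fun i => ⌊x i⌋₊,
      ⟨hL.fract_mem hxL, by simp, ?_⟩, ?_⟩
    · ext i
      have : ((⌊x i⌋₊ : ℕ) : ℝ) = (⌊x i⌋ : ℝ) := by
        exact_mod_cast congrArg (Int.cast : ℤ → ℝ) (Int.natCast_floor_eq_floor (hx0 i))
      simp [this]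
    · obtain ⟨h, hh⟩ := hL.exists_height (hL.fract_mem hxL).1 fun i => Int.fract_nonneg _
      rw [hh]; simp
  have hex2 : ∃ r : ℕ, ∃ w s c, IsRep L x w s c ∧ ∑ i, w i = Nat.find hex ∧ s.length = r := by
    obtain ⟨w, s, c, h1, h2⟩ := Nat.find_spec hex
    exact ⟨_, w, s, c, h1, h2, rfl⟩
  obtain ⟨w, s, c, hrep, hh, hr⟩ := Nat.find_spec hex2
  set h := Nat.find hex with hh_def
  have hmin : ∀ w' s' c', IsRep L x w' s' c' → ∑ i, w i ≤ ∑ i, w' i := by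
    intro w' s' c' h'
    obtain ⟨m, hm⟩ := hL.exists_height h'.mem_unitBox.1 fun i => (h'.mem_unitBox.2 i).1
    rw [hh, hm]
    exact_mod_cast Nat.find_min' hex ⟨w', s', c', h', hm⟩
  have hlt := hrep.length_add_sum_lt hL hx hmin fun w' s' c' h' hs => by
    rw [hr]
    exact Nat.find_min' hex2 ⟨w', s', c', h', by rw [hs, hh], rfl⟩
  have htot : k = h + s.length + ∑ i, c i := by
    have := hxk
    rw [hrep.eq_sum] at this
    simp only [Pi.add_apply, Finset.sum_add_distrib, hh,
      IsRep.sum_sum_eq_length hrep.mem_heightOne] at this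
    exact_mod_cast this.symm
  have hhn : h ≤ n := by
    by_contra! hgt
    obtain ⟨u, hu, hul⟩ := hL.exists_le_of_card_le hrep.mem_unitBox hh (by omega) (by omega)
    have := hmin (w - u) (u :: s) c ⟨⟨L.sub_mem hrep.mem_unitBox.1 hu.1, fun i =>
      ⟨by simpa using hul i, by
        have := (hrep.mem_unitBox.2 i).2
        have := hu.2.1 i
        simp only [Pi.sub_apply]; linarith⟩⟩, by
      intro u' hu'
      obtain rfl | hu' := List.mem_cons.1 hu'
      · exact hu
      · exact hrep.mem_heightOne u' hu', by
      rw [List.sum_cons, hrep.eq_sum]; abel⟩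
    simp only [Pi.sub_apply, Finset.sum_sub_distrib, hu.2.2] at this
    linarith
  omega

/-- The order simplex has at least the expected volume, since its images under permutations of
the coordinates cover the unit cube. -/
theorem one_le_factorial_mul_volume_orderSimplex (d : ℕ) :
    1 ≤ (d.factorial : ENNReal) *
      volume {x : Fin d → ℝ | (∀ i, 0 ≤ x i ∧ x i ≤ 1) ∧ Antitone x} := by
  set Δ := {x : Fin d → ℝ | (∀ i, 0 ≤ x i ∧ x i ≤ 1) ∧ Antitone x} with hΔ
  have hcube : volume (Set.Icc (0 : Fin d → ℝ) 1) = 1 := by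
    simp [Real.volume_Icc_pi]
  have hcov : Set.Icc (0 : Fin d → ℝ) 1 ⊆
      ⋃ σ : Equiv.Perm (Fin d), MeasurableEquiv.piCongrLeft (fun _ => ℝ) σ ⁻¹' Δ := by
    intro x hx
    have hsort := Tuple.monotone_sort fun i => -x i
    refine Set.mem_iUnion.2 ⟨(Tuple.sort fun i => -x i).symm, ?_⟩
    have happ : ∀ i, MeasurableEquiv.piCongrLeft (fun _ => ℝ)
        (Tuple.sort fun i => -x i).symm x i = x (Tuple.sort (fun i => -x i) i) := by
      intro i
      have := Equiv.piCongrLeft_apply_apply (fun _ => ℝ) (Tuple.sort fun i => -x i).symm x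
        (Tuple.sort (fun i => -x i) i)
      rwa [Equiv.symm_apply_apply] at this
    refine ⟨fun i => ?_, fun i j hij => ?_⟩
    · rw [happ]; exact ⟨hx.1 _, hx.2 _⟩
    · rw [happ, happ]
      have := hsort hij
      simp only [Function.comp_apply] at this
      linarith
  calc (1 : ENNReal) = volume (Set.Icc (0 : Fin d → ℝ) 1) := hcube.symm
    _ ≤ _ := measure_mono hcov
    _ ≤ ∑ σ : Equiv.Perm (Fin d),
          volume (MeasurableEquiv.piCongrLeft (fun _ => ℝ) σ ⁻¹' Δ) :=
        measure_iUnion_fintype_le _ _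
    _ = ∑ _σ : Equiv.Perm (Fin d), volume Δ := by
        refine Finset.sum_congr rfl fun σ _ => ?_
        exact (volume_measurePreserving_piCongrLeft (fun _ => ℝ) σ).measure_preimage_equiv Δ
    _ = _ := by simp [Fintype.card_perm]

/-- Coefficients with respect to the vertices, given coefficients with respect to the consecutive
differences of the vertices. -/
theorem sum_smul_diff_eq {d : ℕ} (v : Fin (d + 1) → Fin d → ℝ) (x : Fin d → ℝ) (a : ℝ) :
    a • v 0 + ∑ j, x j • (v j.succ - v j.castSucc) =
      ∑ i, ((Fin.cons a x : Fin (d + 1) → ℝ) i - (Fin.snoc x 0 : Fin (d + 1) → ℝ) i) • v i := by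
  simp only [sub_smul, Finset.sum_sub_distrib, smul_sub]
  rw [Fin.sum_univ_succ (fun i => (Fin.cons a x : Fin (d + 1) → ℝ) i • v i),
    Fin.sum_univ_castSucc (fun i => (Fin.snoc x 0 : Fin (d + 1) → ℝ) i • v i)]
  simp
  abel

theorem sum_cons_sub_snoc {d : ℕ} (x : Fin d → ℝ) (a : ℝ) :
    ∑ i, ((Fin.cons a x : Fin (d + 1) → ℝ) i - (Fin.snoc x 0 : Fin (d + 1) → ℝ) i) = a := by
  rw [Finset.sum_sub_distrib, Fin.sum_univ_succ (Fin.cons a x : Fin (d + 1) → ℝ),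
    Fin.sum_univ_castSucc (Fin.snoc x 0 : Fin (d + 1) → ℝ)]
  simp

theorem eq_zero_of_cons_eq_snoc {d : ℕ} {x : Fin d → ℝ}
    (h : ∀ i, (Fin.cons 0 x : Fin (d + 1) → ℝ) i - (Fin.snoc x 0 : Fin (d + 1) → ℝ) i = 0) :
    x = 0 := by
  have key : ∀ n (hn : n < d), x ⟨n, hn⟩ = 0 := by
    intro n
    induction n with
    | zero =>
      intro hn
      have := h (Fin.castSucc ⟨0, hn⟩)
      rw [Fin.snoc_castSucc] at this
      have h0 : Fin.castSucc (⟨0, hn⟩ : Fin d) = 0 := rfl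
      rw [h0, Fin.cons_zero] at this
      linarith
    | succ n ih =>
      intro hn
      have := h (Fin.castSucc ⟨n + 1, hn⟩)
      rw [Fin.snoc_castSucc] at this
      have h0 : Fin.castSucc (⟨n + 1, hn⟩ : Fin d) = Fin.succ ⟨n, by omega⟩ := rfl
      rw [h0, Fin.cons_succ, ih] at this
      linarith
  ext i
  exact key i i.2

theorem orderSimplex_image_subset {d : ℕ} (v : Fin (d + 1) → Fin d → ℝ) {x : Fin d → ℝ}
    (h01 : ∀ i, 0 ≤ x i ∧ x i ≤ 1) (hx : Antitone x) :
    v 0 + ∑ j, x j • (v j.succ - v j.castSucc) ∈ convexHull ℝ (Set.range v) := by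
  have := sum_smul_diff_eq v x 1
  rw [one_smul] at this
  rw [this]
  refine (convex_convexHull ℝ _).sum_mem (fun i _ => ?_) (sum_cons_sub_snoc x 1)
    fun i _ => subset_convexHull ℝ _ ⟨i, rfl⟩
  induction i using Fin.lastCases with
  | last =>
    rw [Fin.snoc_last, sub_zero]
    refine Fin.cases ?_ (fun j => ?_) (Fin.last d)
    · simp
    · simpa using (h01 j).1
  | cast j =>
    rw [Fin.snoc_castSucc]
    obtain ⟨n, hn⟩ := j
    cases n with
    | zero =>
      have h0 : Fin.castSucc (⟨0, hn⟩ : Fin d) = 0 := rfl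
      rw [h0, Fin.cons_zero]
      linarith [(h01 ⟨0, hn⟩).2]
    | succ n =>
      have h0 : Fin.castSucc (⟨n + 1, hn⟩ : Fin d) = Fin.succ ⟨n, by omega⟩ := rfl
      rw [h0, Fin.cons_succ]
      have : x ⟨n + 1, hn⟩ ≤ x ⟨n, by omega⟩ := hx (by simp [Fin.le_def])
      linarith

theorem abs_det_le_nVol {d : ℕ} (v : Fin (d + 1) → Fin d → ℝ) :
    |(Matrix.of fun j : Fin d => v j.succ - v j.castSucc).det| ≤
      nVol (convexHull ℝ (Set.range v)) := by
  set A : Matrix (Fin d) (Fin d) ℝ := Matrix.of fun j : Fin d => v j.succ - v j.castSucc with hA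
  set Δ := {x : Fin d → ℝ | (∀ i, 0 ≤ x i ∧ x i ≤ 1) ∧ Antitone x} with hΔ
  have himg : (fun y => v 0 + y) '' (Matrix.toLin' A.transpose '' Δ) ⊆
      convexHull ℝ (Set.range v) := by
    rintro _ ⟨_, ⟨x, hx, rfl⟩, rfl⟩
    convert orderSimplex_image_subset v hx.1 hx.2 using 2
    ext i
    simp [Matrix.mulVec, dotProduct, hA, mul_comm]
  have hvol := measure_mono (μ := volume) himg
  rw [Set.image_add_left, measure_preimage_add, Measure.addHaar_image_linearMap,
    LinearMap.det_toLin', Matrix.det_transpose] at hvol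
  have hfin : volume (convexHull ℝ (Set.range v)) ≠ ⊤ :=
    ((Set.finite_range v).isCompact_convexHull ℝ).measure_lt_top.ne
  have h1 : ENNReal.ofReal |A.det| ≤
      (d.factorial : ENNReal) * volume (convexHull ℝ (Set.range v)) :=
    calc ENNReal.ofReal |A.det| = ENNReal.ofReal |A.det| * 1 := (mul_one _).symm
      _ ≤ ENNReal.ofReal |A.det| * ((d.factorial : ENNReal) * volume Δ) := by
          gcongr; exact one_le_factorial_mul_volume_orderSimplex d
      _ = (d.factorial : ENNReal) * (ENNReal.ofReal |A.det| * volume Δ) := by ring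
      _ ≤ _ := by gcongr
  have h2 := ENNReal.toReal_mono (ENNReal.mul_ne_top (by simp) hfin) h1
  rwa [ENNReal.toReal_ofReal (abs_nonneg _), ENNReal.toReal_mul, ENNReal.toReal_natCast] at h2

theorem AffineIndependent.eq_zero_of_sum_eq_zero' {d : ℕ} {v : Fin (d + 1) → Fin d → ℝ}
    (hind : AffineIndependent ℝ v) {a : Fin (d + 1) → ℝ} (h0 : ∑ i, a i = 0)
    (h1 : ∑ i, a i • v i = 0) : ∀ i, a i = 0 := fun i =>
  affineIndependent_iff.1 hind Finset.univ a h0 h1 i (Finset.mem_univ i)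

/-- The group of barycentric coordinates, with respect to `v`, of the lattice points at integral
height in the cone over the simplex spanned by `v`. -/
def baryGroup {d : ℕ} (v : Fin (d + 1) → Fin d → ℝ) : AddSubgroup (Fin (d + 1) → ℝ) where
  carrier := {a | (∃ z : ℤ, ∑ i, a i = z) ∧ IsLatticePt (∑ i, a i • v i)}
  zero_mem' := ⟨⟨0, by simp⟩, fun i => ⟨0, by simp⟩⟩
  add_mem' := by
    rintro a b ⟨⟨z, hz⟩, ha⟩ ⟨⟨z', hz'⟩, hb⟩
    refine ⟨⟨z + z', by simp [Finset.sum_add_distrib, hz, hz']⟩, fun i => ?_⟩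
    obtain ⟨y, hy⟩ := ha i
    obtain ⟨y', hy'⟩ := hb i
    exact ⟨y + y', by
      simp only [Pi.add_apply, add_smul, Finset.sum_add_distrib, hy, hy', Int.cast_add]⟩
  neg_mem' := by
    rintro a ⟨⟨z, hz⟩, ha⟩
    refine ⟨⟨-z, by simp [hz]⟩, fun i => ?_⟩
    obtain ⟨y, hy⟩ := ha i
    exact ⟨-y, by simp only [Pi.neg_apply, neg_smul, Finset.sum_neg_distrib, hy, Int.cast_neg]⟩

/-- The box points inject into the quotient of the lattice by the sublattice spanned by the edges
of the simplex, whose order is at most the normalized volume. -/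
theorem finite_unitBox_and_ncard_le {d : ℕ} {v : Fin (d + 1) → Fin d → ℝ}
    (hlat : ∀ i, IsLatticePt (v i)) (hind : AffineIndependent ℝ v) :
    (unitBox (baryGroup v)).Finite ∧
      ((unitBox (baryGroup v)).ncard : ℝ) ≤ nVol (convexHull ℝ (Set.range v)) := by
  choose V hV using hlat
  have hdiff : ∀ x : Fin d → ℝ, ∑ j, x j • (v j.succ - v j.castSucc) = 0 → x = 0 := by
    intro x hx
    have h1 := sum_smul_diff_eq v x 0
    rw [hx, zero_smul, add_zero] at h1
    exact eq_zero_of_cons_eq_snoc (hind.eq_zero_of_sum_eq_zero' (sum_cons_sub_snoc x 0) h1.symm)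
  set W : Fin d → Fin d → ℤ := fun j => V j.succ - V j.castSucc with hW
  have hWv : ∀ (c : Fin d → ℤ) (l : Fin d), ((∑ j, c j • W j) l : ℤ) =
      (∑ j, (c j : ℝ) • (v j.succ - v j.castSucc)) l := by
    intro c l
    simp [hW, Finset.sum_apply, hV]
  have hli : LinearIndependent ℤ W := by
    rw [Fintype.linearIndependent_iff]
    intro c hc
    have := hdiff (fun j => (c j : ℝ)) (by
      ext l
      rw [← hWv, hc]; simp)
    intro j
    have hj := congrFun this j
    simpa using hj
  have hdet : (Matrix.of W).det ≠ 0 := by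
    intro h0
    obtain ⟨c, hc0, hc⟩ := Matrix.exists_vecMul_eq_zero_iff.2 h0
    refine hc0 (funext (Fintype.linearIndependent_iff.1 hli c ?_))
    rw [← hc]
    ext l
    simp [Matrix.vecMul, dotProduct]
  set N := Submodule.span ℤ (Set.range W) with hN
  have hcard : Nat.card ((Fin d → ℤ) ⧸ N) = (Matrix.of W).det.natAbs := by
    rw [← Submodule.natAbs_det_basis_change (Pi.basisFun ℤ (Fin d)) N (Module.Basis.span hli)]
    congr 1
    rw [Pi.basisFun_det]
    congr 1
    ext j l
    exact congrFun (congrArg Subtype.val (Module.Basis.span_apply hli j)) l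
  have hfinq : Finite ((Fin d → ℤ) ⧸ N) :=
    Nat.finite_of_card_ne_zero (by rw [hcard]; exact Int.natAbs_ne_zero.2 hdet)
  have hz : ∀ w : unitBox (baryGroup v), ∃ (z : Fin d → ℤ) (n : ℤ), ∑ i, w.1 i = n ∧
      ∀ l, (z l : ℝ) = (∑ i, w.1 i • v i) l - n * v 0 l := by
    rintro ⟨w, ⟨⟨n, hn⟩, hlw⟩, -⟩
    have hlw' := hlw
    choose y hy using hlw'
    exact ⟨fun l => y l - n * V 0 l, n, hn, fun l => by push_cast; rw [hy, hV]⟩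
  choose Z n hn hZ using hz
  have hinj : Function.Injective fun w => (Submodule.Quotient.mk (Z w) : (Fin d → ℤ) ⧸ N) := by
    intro w w' he
    obtain ⟨c, hc⟩ := (Submodule.mem_span_range_iff_exists_fun ℤ).1
      ((Submodule.Quotient.eq N).1 he)
    have h1 := sum_smul_diff_eq v (fun j => (c j : ℝ)) (n w - n w' : ℝ)
    have hzero := hind.eq_zero_of_sum_eq_zero' (a := fun i => w.1 i - w'.1 i -
      ((Fin.cons (n w - n w' : ℝ) (fun j => (c j : ℝ)) : Fin (d + 1) → ℝ) i -
        (Fin.snoc (fun j => (c j : ℝ)) 0 : Fin (d + 1) → ℝ) i)) (by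
        rw [Finset.sum_sub_distrib, sum_cons_sub_snoc, Finset.sum_sub_distrib, hn, hn]; ring) (by
        simp only [sub_smul _ (_ - _), Finset.sum_sub_distrib]
        rw [← h1]
        ext l
        have h2 := congrArg (Int.cast : ℤ → ℝ) (congrFun hc l)
        rw [hWv] at h2
        simp only [Pi.sub_apply, Int.cast_sub, hZ] at h2
        simp only [Pi.sub_apply, Pi.add_apply, h2, Pi.smul_apply, smul_eq_mul, sub_smul,
          Finset.sum_sub_distrib, Pi.zero_apply]
        ring)
    apply Subtype.ext
    ext i
    have hi := hzero i
    have hint : ∃ z : ℤ,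
        ((Fin.cons (n w - n w' : ℝ) (fun j => (c j : ℝ)) : Fin (d + 1) → ℝ) i -
        (Fin.snoc (fun j => (c j : ℝ)) 0 : Fin (d + 1) → ℝ) i) = z := by
      obtain ⟨z, hz⟩ : ∃ z : ℤ,
          (Fin.cons (n w - n w' : ℝ) (fun j => (c j : ℝ)) : Fin (d + 1) → ℝ) i = z := by
        refine Fin.cases ⟨n w - n w', by simp⟩ (fun j => ⟨c j, by simp⟩) i
      obtain ⟨z', hz'⟩ : ∃ z : ℤ,
          (Fin.snoc (fun j => (c j : ℝ)) 0 : Fin (d + 1) → ℝ) i = z := by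
        refine Fin.lastCases ⟨0, by simp⟩ (fun j => ⟨c j, by simp⟩) i
      exact ⟨z - z', by rw [hz, hz']; push_cast; ring⟩
    obtain ⟨z, hz⟩ := hint
    simp only [hz] at hi
    have hf : Int.fract (w.1 i) = Int.fract (w'.1 i) := Int.fract_eq_fract.2 ⟨z, by linarith⟩
    rwa [Int.fract_eq_self.2 (w.2.2 i), Int.fract_eq_self.2 (w'.2.2 i)] at hf
  refine ⟨Set.finite_coe_iff.1 (Finite.of_injective _ hinj), ?_⟩
  have hle := Nat.card_le_card_of_injective _ hinj
  rw [Nat.card_coe_set_eq, hcard] at hle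
  refine le_trans ?_ (abs_det_le_nVol v)
  have hdetR : (Matrix.of fun j : Fin d => v j.succ - v j.castSucc).det = ((Matrix.of W).det : ℝ) := by
    rw [Int.cast_det]
    congr 1
    ext j l
    simp [hW, hV]
  rw [hdetR, ← Int.cast_abs, Int.abs_eq_natAbs]
  exact_mod_cast hle

theorem mem_convexHull_range_iff {d : ℕ} {v : Fin (d + 1) → Fin d → ℝ} {x : Fin d → ℝ} :
    x ∈ convexHull ℝ (Set.range v) ↔
      ∃ a : Fin (d + 1) → ℝ, (∀ i, 0 ≤ a i) ∧ ∑ i, a i = 1 ∧ ∑ i, a i • v i = x := by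
  constructor
  · refine fun hx => convexHull_min (t := {x | ∃ a : Fin (d + 1) → ℝ, (∀ i, 0 ≤ a i) ∧
      ∑ i, a i = 1 ∧ ∑ i, a i • v i = x}) ?_ ?_ hx
    · rintro _ ⟨i, rfl⟩
      refine ⟨Pi.single i 1, fun j => ?_, by simp, by simp [Pi.single_apply]⟩
      rw [Pi.single_apply]; split_ifs <;> norm_num
    · rintro _ ⟨a, ha, ha1, rfl⟩ _ ⟨b, hb, hb1, rfl⟩ s t hs ht hst
      refine ⟨fun i => s * a i + t * b i, fun i => ?_, ?_, ?_⟩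
      · have := ha i
        have := hb i
        positivity
      · rw [Finset.sum_add_distrib, ← Finset.mul_sum, ← Finset.mul_sum, ha1, hb1]
        linarith
      · simp only [add_smul, mul_smul, Finset.sum_add_distrib, ← Finset.smul_sum]
  · rintro ⟨a, ha, ha1, rfl⟩
    exact (convex_convexHull ℝ _).sum_mem (fun i _ => ha i) ha1
      fun i _ => subset_convexHull ℝ _ ⟨i, rfl⟩

theorem mem_latticePts_convexHull_iff {d : ℕ} {v : Fin (d + 1) → Fin d → ℝ} {x : Fin d → ℝ} :
    x ∈ latticePts (convexHull ℝ (Set.range v)) ↔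
      ∃ a ∈ heightOne (baryGroup v), ∑ i, a i • v i = x := by
  constructor
  · rintro ⟨hx, hl⟩
    obtain ⟨a, ha, ha1, rfl⟩ := mem_convexHull_range_iff.1 hx
    exact ⟨a, ⟨⟨⟨1, by simp [ha1]⟩, hl⟩, ha, ha1⟩, rfl⟩
  · rintro ⟨a, ⟨⟨-, hl⟩, ha, ha1⟩, rfl⟩
    exact ⟨mem_convexHull_range_iff.2 ⟨a, ha, ha1, rfl⟩, hl⟩

theorem vertex_mem_extremePoints {d : ℕ} {v : Fin (d + 1) → Fin d → ℝ}
    (hind : AffineIndependent ℝ v) (i : Fin (d + 1)) :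
    v i ∈ (convexHull ℝ (Set.range v)).extremePoints ℝ := by
  refine mem_extremePoints_iff_left.2 ⟨subset_convexHull ℝ _ ⟨i, rfl⟩, ?_⟩
  rintro x hx y hy ⟨s, t, hs, ht, hst, hxy⟩
  obtain ⟨a, ha, ha1, rfl⟩ := mem_convexHull_range_iff.1 hx
  obtain ⟨b, hb, hb1, rfl⟩ := mem_convexHull_range_iff.1 hy
  have h0 := hind.eq_zero_of_sum_eq_zero'
    (a := fun l => s * a l + t * b l - (Pi.single i 1 : Fin (d + 1) → ℝ) l) (by
      rw [Finset.sum_sub_distrib, Finset.sum_add_distrib, ← Finset.mul_sum, ← Finset.mul_sum, ha1,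
        hb1]
      simp; linarith) (by
      simp only [sub_smul, add_smul, mul_smul, Finset.sum_sub_distrib, Finset.sum_add_distrib,
        ← Finset.smul_sum, hxy]
      simp [Pi.single_apply])
  have hz : ∀ l ≠ i, a l = 0 := by
    intro l hl
    have := h0 l
    simp only [Pi.single_eq_of_ne hl] at this
    have h1 := mul_nonneg hs.le (ha l)
    have h2 := mul_nonneg ht.le (hb l)
    have h3 : s * a l = 0 := by linarith
    exact (mul_eq_zero.1 h3).resolve_left hs.ne'
  rw [Fintype.sum_eq_single i hz] at ha1
  rw [Fintype.sum_eq_single i fun l hl => by rw [hz l hl, zero_smul], ha1, one_smul]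

theorem IsVeryAmple.isVeryAmpleGroup {d : ℕ} {v : Fin (d + 1) → Fin d → ℝ}
    (hlat : ∀ i, IsLatticePt (v i)) (hind : AffineIndependent ℝ v)
    (hva : IsVeryAmple (convexHull ℝ (Set.range v))) : IsVeryAmpleGroup (baryGroup v) where
  single_mem i := ⟨⟨1, by simp⟩, by simpa [Pi.single_apply] using hlat i⟩
  sum_int x hx := hx.1
  finite_unitBox := (finite_unitBox_and_ncard_le hlat hind).1
  exists_le i x hx hnn hne := by
    obtain ⟨l₀, hl₀, hxl₀⟩ := hne
    obtain ⟨⟨z, hz⟩, hxl⟩ := hx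
    set t := ∑ l ∈ Finset.univ.erase i, x l with ht
    have hsplit : x i + t = z := by rw [← hz, ht, Finset.add_sum_erase _ _ (Finset.mem_univ i)]
    have ht0 : 0 < t := Finset.sum_pos' (fun l hl => hnn l (Finset.ne_of_mem_erase hl))
      ⟨l₀, Finset.mem_erase.2 ⟨hl₀, Finset.mem_univ _⟩, (hnn l₀ hl₀).lt_of_ne' hxl₀⟩
    have hsplitv : x i • v i + ∑ l ∈ Finset.univ.erase i, x l • v l = ∑ l, x l • v l :=
      Finset.add_sum_erase _ (fun l => x l • v l) (Finset.mem_univ i)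
    have hlat' : IsLatticePt (∑ l, x l • v l - (z : ℝ) • v i) := by
      intro j
      obtain ⟨y, hy⟩ := hxl j
      obtain ⟨y', hy'⟩ := hlat i j
      exact ⟨y - z * y', by
        rw [Pi.sub_apply, hy, Pi.smul_apply, hy', smul_eq_mul]; push_cast; ring⟩
    have hcone : ∑ l, x l • v l - (z : ℝ) • v i ∈
        coneOver ((fun p => p - v i) '' convexHull ℝ (Set.range v)) := by
      refine ⟨t, t⁻¹ • (∑ l ∈ Finset.univ.erase i, x l • v l) - v i, ⟨_, ?_, rfl⟩, ht0.le, ?_⟩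
      · rw [Finset.smul_sum]
        simp only [smul_smul]
        refine (convex_convexHull ℝ _).sum_mem (fun l hl => ?_) ?_ fun l _ =>
          subset_convexHull ℝ _ ⟨l, rfl⟩
        · exact mul_nonneg (inv_nonneg.2 ht0.le) (hnn l (Finset.ne_of_mem_erase hl))
        · rw [← Finset.mul_sum, ← ht, inv_mul_cancel₀ ht0.ne']
      · rw [smul_sub, smul_smul, mul_inv_cancel₀ ht0.ne', one_smul, ← hsplitv, ← hsplit, add_smul]
        abel
    obtain ⟨m, u, hu, hsum⟩ := hva (v i) (vertex_mem_extremePoints hind i) _ hlat' hcone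
    simp only [mem_latticePts_convexHull_iff] at hu
    choose a ha hau using hu
    have h0 := hind.eq_zero_of_sum_eq_zero'
      (a := fun l => x l - ∑ j, a j l - (Pi.single i ((z : ℝ) - m) : Fin (d + 1) → ℝ) l) (by
        rw [Finset.sum_sub_distrib, Finset.sum_sub_distrib, hz, Finset.sum_comm]
        simp [(ha _).2.2]) (by
        simp only [sub_smul, Finset.sum_sub_distrib, Finset.sum_smul]
        rw [Finset.sum_comm]
        simp only [hau]
        rw [Finset.sum_sub_distrib] at hsum
        simp only [Finset.sum_const, Finset.card_univ, Fintype.card_fin] at hsum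
        have hsing : ∑ l, (Pi.single i ((z : ℝ) - m) : Fin (d + 1) → ℝ) l • v l =
            ((z : ℝ) - m) • v i := by
          rw [Fintype.sum_eq_single i fun l hl => by rw [Pi.single_eq_of_ne hl, zero_smul],
            Pi.single_eq_same]
        rw [hsing, sub_smul, Nat.cast_smul_eq_nsmul, ← sub_eq_zero.2 hsum]
        abel)
    have hx_eq : ∀ l ≠ i, x l = ∑ j, a j l := by
      intro l hl
      have := h0 l
      simp only [Pi.single_eq_of_ne hl] at this
      linarith
    obtain ⟨j, -, hj⟩ : ∃ j ∈ Finset.univ, a j l₀ ≠ 0 :=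
      Finset.exists_ne_zero_of_sum_ne_zero (hx_eq l₀ hl₀ ▸ hxl₀)
    refine ⟨a j, ha j, ?_, fun l hl => ?_⟩
    · have h1 := Finset.add_sum_erase Finset.univ (a j) (Finset.mem_univ i)
      rw [(ha j).2.2] at h1
      have h2 := Finset.single_le_sum (f := a j) (fun l _ => (ha j).2.1 l)
        (Finset.mem_erase.2 ⟨hl₀, Finset.mem_univ l₀⟩)
      have h3 := ((ha j).2.1 l₀).lt_of_ne' hj
      linarith
    · rw [hx_eq l hl]
      exact Finset.single_le_sum (f := fun j => a j l) (fun j _ => (ha j).2.1 l)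
        (Finset.mem_univ j)

theorem heightOne_subset {d : ℕ} (L : AddSubgroup (Fin (d + 1) → ℝ)) :
    heightOne L ⊆ {w | w ∈ unitBox L ∧ ∑ i, w i = 1} ∪
      Set.range fun i : Fin (d + 1) => (Pi.single i 1 : Fin (d + 1) → ℝ) := by
  intro u hu
  by_cases hlt : ∀ i, u i < 1
  · exact Or.inl ⟨⟨hu.1, fun i => ⟨hu.2.1 i, hlt i⟩⟩, hu.2.2⟩
  · push Not at hlt
    obtain ⟨i, hi⟩ := hlt
    refine Or.inr ⟨i, ?_⟩
    have hs := Finset.add_sum_erase Finset.univ u (Finset.mem_univ i)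
    rw [hu.2.2] at hs
    have hnn : 0 ≤ ∑ l ∈ Finset.univ.erase i, u l := Finset.sum_nonneg fun l _ => hu.2.1 l
    have hz := (Finset.sum_eq_zero_iff_of_nonneg fun l _ => hu.2.1 l).1
      (show ∑ l ∈ Finset.univ.erase i, u l = 0 by linarith)
    ext l
    by_cases hl : l = i
    · subst hl
      simp only [Pi.single_eq_same]
      linarith
    · simp [hl, hz l (Finset.mem_erase.2 ⟨hl, Finset.mem_univ l⟩)]

/-- Counting box points by height. -/
theorem ncard_highBox_add_ncard_heightOne_le {d : ℕ} {L : AddSubgroup (Fin (d + 1) → ℝ)}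
    (hL : IsVeryAmpleGroup L) :
    (highBox L).ncard + (heightOne L).ncard ≤ (unitBox L).ncard + d := by
  set B := {w | w ∈ unitBox L ∧ ∑ i, w i = 1} with hB
  have hBfin : B.Finite := hL.finite_unitBox.subset fun _ h => h.1
  have h1 : (heightOne L).ncard ≤ B.ncard + (d + 1) := by
    refine (Set.ncard_le_ncard (heightOne_subset L) (hBfin.union (Set.finite_range _))).trans
      ((Set.ncard_union_le _ _).trans ?_)
    gcongr
    refine (Set.ncard_le_ncard (Set.image_univ (f := fun i : Fin (d + 1) =>
      (Pi.single i 1 : Fin (d + 1) → ℝ))).ge (Set.toFinite _)).trans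
      ((Set.ncard_image_le (Set.toFinite _)).trans ?_)
    simp [Set.ncard_univ]
  have hdisj : Disjoint (highBox L) B := Set.disjoint_left.2 fun w h h' => by
    have := h.2
    rw [h'.2] at this
    norm_num at this
  have h2 : (insert 0 (highBox L ∪ B)).ncard ≤ (unitBox L).ncard := by
    refine Set.ncard_le_ncard ?_ hL.finite_unitBox
    rintro w (rfl | h | h)
    · exact ⟨L.zero_mem, fun i => by simp⟩
    · exact h.1
    · exact h.1
  rw [Set.ncard_insert_of_notMem (by
    rintro (h | h)
    · have := h.2
      simp at this
      linarith
    · simpa using h.2) (hL.finite_highBox.union hBfin),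
    Set.ncard_union_eq hdisj hL.finite_highBox hBfin] at h2
  omega

theorem ncard_latticePts_le {d : ℕ} {v : Fin (d + 1) → Fin d → ℝ}
    (hfin : (heightOne (baryGroup v)).Finite) :
    (latticePts (convexHull ℝ (Set.range v))).ncard ≤ (heightOne (baryGroup v)).ncard := by
  have : latticePts (convexHull ℝ (Set.range v)) =
      (fun a : Fin (d + 1) → ℝ => ∑ i, a i • v i) '' heightOne (baryGroup v) := by
    ext x
    exact mem_latticePts_convexHull_iff
  rw [this]
  exact Set.ncard_image_le hfin

theorem isKNormal_of_le {d : ℕ} {v : Fin (d + 1) → Fin d → ℝ} (hd : 2 ≤ d)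
    (hL : IsVeryAmpleGroup (baryGroup v)) {k : ℕ}
    (hk : (highBox (baryGroup v)).ncard + d / 2 ≤ k) :
    IsKNormal (convexHull ℝ (Set.range v)) k := by
  rintro x ⟨⟨p, hp, rfl⟩, hx⟩
  obtain ⟨a, ha, ha1, rfl⟩ := mem_convexHull_range_iff.1 hp
  have heq : (k : ℝ) • ∑ i, a i • v i = ∑ i, ((k : ℝ) • a) i • v i := by
    rw [Finset.smul_sum]
    simp [mul_smul]
  have hsum : ∑ i, ((k : ℝ) • a) i = k := by simp [← Finset.mul_sum, ha1]
  have hmem := hL.mem_closure_heightOne (n := d / 2) (by omega)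
    (by rw [Fintype.card_fin]; omega) hk (x := (k : ℝ) • a)
    ⟨⟨k, by simpa using hsum⟩, heq ▸ hx⟩
    (fun i => mul_nonneg k.cast_nonneg (ha i)) hsum
  obtain ⟨l, hl, hls⟩ := AddSubmonoid.exists_list_of_mem_closure hmem
  have hlen : l.length = k := by
    have := IsRep.sum_sum_eq_length hl
    rw [hls, hsum] at this
    exact_mod_cast this.symm
  subst hlen
  refine ⟨fun j => ∑ i, l.get j i • v i, fun j => mem_latticePts_convexHull_iff.2
    ⟨l.get j, hl _ (List.get_mem _ _), rfl⟩, ?_⟩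
  show ((l.length : ℝ) • ∑ i, a i • v i) = _
  rw [heq, Finset.sum_comm, ← hls]
  refine Finset.sum_congr rfl fun i _ => ?_
  rw [← Finset.sum_smul]
  congr 1
  rw [← Finset.sum_apply i Finset.univ fun j => l.get j]
  rw [← List.sum_ofFn, List.ofFn_get]

theorem le_of_mem_latticePts_interior {d : ℕ} {v : Fin (d + 1) → Fin d → ℝ}
    (hind : AffineIndependent ℝ v) (hL : IsVeryAmpleGroup (baryGroup v)) {k : ℕ} (hk : 1 ≤ k)
    {x : Fin d → ℝ} (hx : x ∈ latticePts (interior ((k : ℝ) • convexHull ℝ (Set.range v)))) :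
    d ≤ k + (highBox (baryGroup v)).ncard := by
  obtain ⟨hx, hlx⟩ := hx
  have hk0 : (0 : ℝ) < k := by exact_mod_cast hk
  rw [interior_smul₀ hk0.ne'] at hx
  obtain ⟨p, hp, rfl⟩ := hx
  let b : AffineBasis (Fin (d + 1)) ℝ (Fin d → ℝ) :=
    ⟨v, hind, hind.affineSpan_eq_top_iff_card_eq_finrank_add_one.2 (by simp)⟩
  have hb : interior (convexHull ℝ (Set.range v)) = {x | ∀ i, 0 < b.coord i x} :=
    b.interior_convexHull
  rw [hb] at hp
  set a : Fin (d + 1) → ℝ := fun i => (k : ℝ) * b.coord i p with ha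
  have ha0 : ∀ i, 0 < a i := fun i => mul_pos hk0 (hp i)
  have hasum : ∑ i, a i = k := by
    rw [ha, ← Finset.mul_sum, b.sum_coord_apply_eq_one, mul_one]
  have hav : ∑ i, a i • v i = (k : ℝ) • p := by
    conv_rhs => rw [← b.linear_combination_coord_eq_self p, Finset.smul_sum]
    simp only [ha, mul_smul]
    rfl
  have haL : a ∈ baryGroup v := ⟨⟨k, by simpa using hasum⟩, hav ▸ hlx⟩
  have hw := hL.fract_mem ((baryGroup v).neg_mem haL)
  obtain ⟨h, hh⟩ := hL.exists_height hw.1 fun i => (hw.2 i).1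
  have hle := hL.height_le hw hh
  have hge : (d + 1 : ℝ) - k ≤ h := by
    rw [← hh, ← hasum]
    have : ∀ i, 1 - a i ≤ Int.fract ((-a) i) := by
      intro i
      have h1 : ⌊(-a) i⌋ ≤ -1 := by
        have : ⌊(-a) i⌋ < 0 := Int.floor_lt.2 (by simpa using ha0 i)
        omega
      have h2 : (⌊(-a) i⌋ : ℝ) ≤ -1 := by exact_mod_cast h1
      rw [Int.fract]
      simp only [Pi.neg_apply] at h2 ⊢
      linarith
    refine le_trans (le_of_eq ?_) (Finset.sum_le_sum fun i _ => this i)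
    simp
  have : d + 1 ≤ h + k := by
    have : (d + 1 : ℝ) ≤ h + k := by linarith
    exact_mod_cast this
  omega

theorem polyDeg_le {d : ℕ} {v : Fin (d + 1) → Fin d → ℝ} (hind : AffineIndependent ℝ v)
    (hL : IsVeryAmpleGroup (baryGroup v)) :
    polyDeg (convexHull ℝ (Set.range v)) ≤ (highBox (baryGroup v)).ncard + 1 := by
  unfold polyDeg
  split_ifs with hne
  · obtain ⟨x, hx⟩ := hne
    have := le_of_mem_latticePts_interior hind hL (le_refl 1) (x := x) (by simpa using hx)
    omega
  · refine Nat.sInf_le fun k hk hkd => Set.eq_empty_of_forall_notMem fun x hx => ?_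
    have := le_of_mem_latticePts_interior hind hL hk hx
    omega

/-- the Eisenbud–Goto-type bound
`max {k_P, deg P} ≤ Vol(P) - |P ∩ M| + d + ⌊d/2⌋` for very ample simplices. -/
theorem stmt5 {d : ℕ} (v : Fin (d + 1) → Fin d → ℝ)
    (hlat : ∀ i, IsLatticePt (v i)) (hind : AffineIndependent ℝ v) (hd : 2 ≤ d)
    (hva : IsVeryAmple (convexHull ℝ (Set.range v))) :
    (max (kNormality (convexHull ℝ (Set.range v)))
        (polyDeg (convexHull ℝ (Set.range v))) : ℝ) ≤
      nVol (convexHull ℝ (Set.range v)) -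
        (latticePts (convexHull ℝ (Set.range v))).ncard + d + (d / 2 : ℕ) := by
  have hL := hva.isVeryAmpleGroup hlat hind
  have hfin : (heightOne (baryGroup v)).Finite :=
    ((hL.finite_unitBox.subset fun _ h => h.1).union (Set.finite_range fun i : Fin (d + 1) =>
      (Pi.single i 1 : Fin (d + 1) → ℝ))).subset (heightOne_subset _)
  have hcount := ncard_highBox_add_ncard_heightOne_le hL
  have hpts := ncard_latticePts_le hfin
  have hbox := (finite_unitBox_and_ncard_le hlat hind).2
  have hnorm : kNormality (convexHull ℝ (Set.range v)) ≤
      (highBox (baryGroup v)).ncard + d / 2 :=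
    Nat.sInf_le ⟨by omega, fun k hk => isKNormal_of_le hd hL hk⟩
  have hdeg : polyDeg (convexHull ℝ (Set.range v)) ≤
      (highBox (baryGroup v)).ncard + d / 2 := (polyDeg_le hind hL).trans (by omega)
  have hcount' : ((highBox (baryGroup v)).ncard : ℝ) +
      (latticePts (convexHull ℝ (Set.range v))).ncard ≤ (unitBox (baryGroup v)).ncard + d := by
    exact_mod_cast (Nat.add_le_add_left hpts _).trans hcount
  have hmax : (max (kNormality (convexHull ℝ (Set.range v)))
      (polyDeg (convexHull ℝ (Set.range v))) : ℝ) ≤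
      (highBox (baryGroup v)).ncard + (d / 2 : ℕ) :=
    max_le (by exact_mod_cast hnorm) (by exact_mod_cast hdeg)
  linarith
end
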